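/- arXiv:1201.5471 — 4 statements merged into one kernel-verified Lean document; each statement's English description precedes it below -/
import Mathlib

section
/- Let Y be a real Banach space, F ⊆ Y and A ⊆ Y* bounded sets. If the double limit interchange condition lim_m lim_n y*_m(y_n) = lim_n lim_m y*_m(y_n) holds (whenever all iterated limits exist) for all sequences (y_n) in F and (y*_m) in A, then it also holds for all sequences (y*_m) in the absolutely convex hull aco(A) = co(A ∪ (−A)). -/
open Filter Topology Metric Bornology

noncomputable section

variable {X : Type*} [NormedAddCommGroup X] [NormedSpace ℝ X]

/-- Topology of pointwise convergence on a set `D` of functionals. -/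
def ptwTop (D : Set (X →L[ℝ] ℝ)) : TopologicalSpace X :=
  TopologicalSpace.induced (fun x (d : D) => (d : X →L[ℝ] ℝ) x) Pi.topologicalSpace

/-- Weak-star topology on the dual of `X`. -/
def wstarTop (X : Type*) [NormedAddCommGroup X] [NormedSpace ℝ X] :
    TopologicalSpace (X →L[ℝ] ℝ) :=
  TopologicalSpace.induced (fun f (x : X) => f x) Pi.topologicalSpace

/-- Weak-star closure of a set of functionals. -/
def wstarClosure (A : Set (X →L[ℝ] ℝ)) : Set (X →L[ℝ] ℝ) :=
  @closure _ (wstarTop X) A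

/-- Weak topology on `X`. -/
def weakTop (X : Type*) [NormedAddCommGroup X] [NormedSpace ℝ X] :
    TopologicalSpace X :=
  TopologicalSpace.induced (fun x (f : X →L[ℝ] ℝ) => f x) Pi.topologicalSpace

/-- `aco_∞(A)`: absolutely convex series combinations of elements of `A`. -/
def acoInf (A : Set X) : Set X :=
  {x | ∃ (α : ℕ → ℝ) (u : ℕ → X), (∀ n, u n ∈ A) ∧ Summable (fun n => |α n|) ∧
    (∑' n, |α n|) = 1 ∧ HasSum (fun n => α n • u n) x}

/-- absolutely convex hull -/
def aco (A : Set X) : Set X := convexHull ℝ (A ∪ -A)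

/-- subspace topology -/
def subTop {α : Type*} (t : TopologicalSpace α) (s : Set α) : TopologicalSpace s :=
  TopologicalSpace.induced (Subtype.val : s → α) t

/-- The double limit interchange condition for sets `F ⊆ Y` and `A ⊆ Y*`:
whenever all involved iterated limits exist, they agree. -/
def DoubleLimitCond {Y : Type*} [NormedAddCommGroup Y] [NormedSpace ℝ Y]
    (F : Set Y) (A : Set (Y →L[ℝ] ℝ)) : Prop :=
  ∀ (y : ℕ → Y) (ys : ℕ → (Y →L[ℝ] ℝ)), (∀ n, y n ∈ F) → (∀ m, ys m ∈ A) →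
    ∀ (a b : ℕ → ℝ) (L₁ L₂ : ℝ),
      (∀ m, Tendsto (fun n => ys m (y n)) atTop (𝓝 (a m))) →
      Tendsto a atTop (𝓝 L₁) →
      (∀ n, Tendsto (fun m => ys m (y n)) atTop (𝓝 (b n))) →
      Tendsto b atTop (𝓝 L₂) →
      L₁ = L₂

open MeasureTheory

lemma exists_continuousMap_tendsto {K : Type*} [TopologicalSpace K] [FirstCountableTopology K]
    {S : Set K} (hS : Dense S) (g : ℕ → C(K, ℝ)) (M : ℝ) (hM : ∀ n x, g n x ∈ Set.Icc (-M) M)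
    (hconv : ∀ x ∈ S, ∃ c, Tendsto (fun n => g n x) atTop (𝓝 c))
    (hD : ∀ (u : ℕ → K) (ψ : ℕ → ℕ) (x : K) (a : ℕ → ℝ) (c d : ℝ), (∀ j, u j ∈ S) →
      Tendsto u atTop (𝓝 x) → (∀ j, Tendsto (fun n => g (ψ n) (u j)) atTop (𝓝 (a j))) →
      Tendsto a atTop (𝓝 d) → Tendsto (fun n => g (ψ n) x) atTop (𝓝 c) → d = c) :
    ∃ f : C(K, ℝ), ∀ x, Tendsto (fun n => g n x) atTop (𝓝 (f x)) := by
  choose! p hp using hconv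
  have hpM : ∀ x ∈ S, p x ∈ Set.Icc (-M) M := fun x hx =>
    isClosed_Icc.mem_of_tendsto (hp x hx) (Eventually.of_forall fun n => hM n x)
  have key : ∀ (u : ℕ → K) (x : K) (d : ℝ), (∀ j, u j ∈ S) → Tendsto u atTop (𝓝 x) →
      Tendsto (p ∘ u) atTop (𝓝 d) → Tendsto (fun n => g n x) atTop (𝓝 d) := by
    intro u x d hu hux hd
    refine tendsto_of_subseq_tendsto fun ns hns => ?_
    obtain ⟨c, -, ms, hms, hc⟩ :=
      isCompact_Icc.tendsto_subseq (x := fun n => g (ns n) x) fun n => hM (ns n) x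
    have hdc : d = c := hD u (ns ∘ ms) x (p ∘ u) c d hu hux
      (fun j => (hp (u j) (hu j)).comp (hns.comp hms.tendsto_atTop)) hd hc
    exact ⟨ms, hdc ▸ hc⟩
  have hlim : ∀ x, ∃ d, Tendsto (fun n => g n x) atTop (𝓝 d) := by
    intro x
    obtain ⟨u, hu, hux⟩ := mem_closure_iff_seq_limit.1 (hS x)
    obtain ⟨d, -, ms, hms, hd⟩ :=
      isCompact_Icc.tendsto_subseq (x := p ∘ u) fun n => hpM _ (hu n)
    exact ⟨d, key (u ∘ ms) x d (fun j => hu _) (hux.comp hms.tendsto_atTop) hd⟩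
  choose f hf using hlim
  have hpf : ∀ x, Tendsto p (𝓝[S] x) (𝓝 (f x)) := by
    intro x
    refine tendsto_of_subseq_tendsto fun ns hns => ?_
    obtain ⟨hnx, hnS⟩ := tendsto_nhdsWithin_iff.1 hns
    obtain ⟨N, hN⟩ := eventually_atTop.1 hnS
    obtain ⟨d, -, ms, hms, hd⟩ := isCompact_Icc.tendsto_subseq
      (x := fun n => p (ns (n + N))) fun n => hpM _ (hN _ (Nat.le_add_left N n))
    have hdf : d = f x := tendsto_nhds_unique
      (key (fun n => ns (ms n + N)) x d (fun j => hN _ (Nat.le_add_left N _))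
        (hnx.comp ((tendsto_add_atTop_nat N).comp hms.tendsto_atTop)) hd) (hf x)
    exact ⟨fun n => ms n + N, hdf ▸ hd⟩
  have hext : extendFrom S p = f := funext fun x => extendFrom_eq (hS x) (hpf x)
  exact ⟨⟨f, hext ▸ continuous_extendFrom hS fun x => ⟨f x, hpf x⟩⟩, hf⟩

lemma exists_subseq_tendsto_continuousMap {K : Type*} [TopologicalSpace K]
    [SecondCountableTopology K] {S : Set K} (hS : Dense S) (g : ℕ → C(K, ℝ)) (M : ℝ)
    (hM : ∀ n x, g n x ∈ Set.Icc (-M) M)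
    (hD : ∀ (u : ℕ → K) (ψ : ℕ → ℕ) (x : K) (a : ℕ → ℝ) (c d : ℝ), (∀ j, u j ∈ S) →
      Tendsto u atTop (𝓝 x) → (∀ j, Tendsto (fun n => g (ψ n) (u j)) atTop (𝓝 (a j))) →
      Tendsto a atTop (𝓝 d) → Tendsto (fun n => g (ψ n) x) atTop (𝓝 c) → d = c) :
    ∃ φ : ℕ → ℕ, StrictMono φ ∧
      ∃ f : C(K, ℝ), ∀ x, Tendsto (fun n => g (φ n) x) atTop (𝓝 (f x)) := by
  obtain ⟨t, htS, htc, ht⟩ := hS.exists_countable_dense_subset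
  have := htc.to_subtype
  obtain ⟨v, -, φ, hφ, hv⟩ :=
    (isCompact_univ_pi fun _ : t => isCompact_Icc (a := -M) (b := M)).tendsto_subseq
      (x := fun n (x : t) => g n x) fun n x _ => hM n x
  refine ⟨φ, hφ, exists_continuousMap_tendsto ht (g ∘ φ) M (fun n => hM (φ n))
    (fun x hx => ⟨v ⟨x, hx⟩, tendsto_pi_nhds.1 hv ⟨x, hx⟩⟩) ?_⟩
  intro u ψ x a c d hu
  exact hD u (φ ∘ ψ) x a c d fun j => htS (hu j)

lemma convex_setOf_integral_eq {K ι : Type*} [TopologicalSpace K] [CompactSpace K]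
    [MeasurableSpace K] [BorelSpace K] (g : ι → C(K, ℝ)) :
    Convex ℝ {v : ι → ℝ | ∃ μ : ProbabilityMeasure K, ∀ i, ∫ x, g i x ∂(μ : Measure K) = v i} := by
  rintro v ⟨μ, hμ⟩ w ⟨ν, hν⟩ a b ha hb hab
  have hprob : IsProbabilityMeasure
      (ENNReal.ofReal a • (μ : Measure K) + ENNReal.ofReal b • (ν : Measure K)) := by
    constructor
    simp [← ENNReal.ofReal_add ha hb, hab]
  refine ⟨⟨_, hprob⟩, fun i => ?_⟩
  have hint (ρ : ProbabilityMeasure K) : Integrable (g i) (ρ : Measure K) :=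
    (BoundedContinuousFunction.mkOfCompact (g i)).integrable _
  rw [ProbabilityMeasure.coe_mk, integral_add_measure
    ((hint μ).smul_measure ENNReal.ofReal_ne_top) ((hint ν).smul_measure ENNReal.ofReal_ne_top),
    integral_smul_measure, integral_smul_measure, hμ, hν]
  simp [ha, hb]

lemma iterated_integral_limits_eq {K : Type*} [TopologicalSpace K] [CompactSpace K]
    [TopologicalSpace.MetrizableSpace K] [MeasurableSpace K] [BorelSpace K]
    (g : ℕ → C(K, ℝ)) (f : C(K, ℝ)) (M : ℝ) (hM : ∀ n x, g n x ∈ Set.Icc (-M) M)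
    (hgf : ∀ x, Tendsto (fun n => g n x) atTop (𝓝 (f x)))
    (μ : ℕ → ProbabilityMeasure K) (a b : ℕ → ℝ) (L₁ L₂ : ℝ)
    (ha : ∀ m, Tendsto (fun n => ∫ x, g n x ∂(μ m : Measure K)) atTop (𝓝 (a m)))
    (hL₁ : Tendsto a atTop (𝓝 L₁))
    (hb : ∀ n, Tendsto (fun m => ∫ x, g n x ∂(μ m : Measure K)) atTop (𝓝 (b n)))
    (hL₂ : Tendsto b atTop (𝓝 L₂)) : L₁ = L₂ := by
  let U : Ultrafilter ℕ := Ultrafilter.of atTop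
  have hU : (U : Filter ℕ) ≤ atTop := Ultrafilter.of_le atTop
  obtain ⟨ν, -, hν⟩ := isCompact_univ.ultrafilter_le_nhds (U.map μ) (by simp)
  have hν' (k : C(K, ℝ)) : Tendsto (fun m => ∫ x, k x ∂(μ m : Measure K)) U
      (𝓝 (∫ x, k x ∂(ν : Measure K))) :=
    ProbabilityMeasure.tendsto_iff_forall_integral_tendsto.1 hν
      (BoundedContinuousFunction.mkOfCompact k)
  have hdom (ρ : ProbabilityMeasure K) : Tendsto (fun n => ∫ x, g n x ∂(ρ : Measure K)) atTop
      (𝓝 (∫ x, f x ∂(ρ : Measure K))) :=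
    tendsto_integral_of_dominated_convergence (fun _ => M)
      (fun n => (g n).continuous.aestronglyMeasurable) (integrable_const M)
      (fun n => Eventually.of_forall fun x => abs_le.2 (hM n x)) (Eventually.of_forall hgf)
  have haf : a = fun m => ∫ x, f x ∂(μ m : Measure K) :=
    funext fun m => tendsto_nhds_unique (ha m) (hdom (μ m))
  have hbν : b = fun n => ∫ x, g n x ∂(ν : Measure K) :=
    funext fun n => tendsto_nhds_unique ((hb n).mono_left hU) (hν' (g n))
  rw [tendsto_nhds_unique (hL₁.mono_left hU) (haf ▸ hν' f),
    tendsto_nhds_unique hL₂ (hbν ▸ hdom ν)]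

lemma DoubleLimitCond.union_neg {Y : Type*} [NormedAddCommGroup Y] [NormedSpace ℝ Y]
    {F : Set Y} {A : Set (Y →L[ℝ] ℝ)} (h : DoubleLimitCond F A) :
    DoubleLimitCond F (A ∪ -A) := by
  intro y ys hy hys a b L₁ L₂ ha hL₁ hb hL₂
  have hfreq : (∃ᶠ m in atTop, ys m ∈ A) ∨ ∃ᶠ m in atTop, ys m ∈ -A :=
    frequently_or_distrib.1 (Frequently.of_forall hys)
  rcases hfreq with hA | hA <;> obtain ⟨φ, hφ, hA⟩ := extraction_of_frequently_atTop hA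
  · exact h y (ys ∘ φ) hy hA (a ∘ φ) b L₁ L₂ (fun m => ha (φ m))
      (hL₁.comp hφ.tendsto_atTop) (fun n => (hb n).comp hφ.tendsto_atTop) hL₂
  · exact neg_injective <| h y (fun m => -ys (φ m)) hy hA (fun m => -a (φ m)) (fun n => -b n)
      (-L₁) (-L₂) (fun m => (ha (φ m)).neg) (hL₁.comp hφ.tendsto_atTop).neg
      (fun n => ((hb n).comp hφ.tendsto_atTop).neg) hL₂.neg

lemma DoubleLimitCond.convexHull {Y : Type*} [NormedAddCommGroup Y] [NormedSpace ℝ Y]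
    {F : Set Y} {B : Set (Y →L[ℝ] ℝ)} (hF : IsBounded F) (hB : IsBounded B)
    (h : DoubleLimitCond F B) : DoubleLimitCond F (convexHull ℝ B) := by
  intro y ys hy hys a b L₁ L₂ ha hL₁ hb hL₂
  obtain ⟨CF, hCF⟩ := hF.exists_norm_le
  obtain ⟨CB, hCB⟩ := hB.exists_norm_le
  let M : ℝ := CB * CF
  let ev : (Y →L[ℝ] ℝ) →ₗ[ℝ] (ℕ → ℝ) :=
    LinearMap.pi fun n => (ContinuousLinearMap.apply ℝ ℝ (y n)).toLinearMap
  have hev : ∀ z n, ev z n = z (y n) := fun _ _ => rfl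
  have hbox : closure (ev '' B) ⊆ Set.pi Set.univ fun _ => Set.Icc (-M) M := by
    refine closure_minimal ?_ (isClosed_set_pi fun _ _ => isClosed_Icc)
    rintro _ ⟨z, hz, rfl⟩ n -
    refine abs_le.1 ((z.le_opNorm (y n)).trans ?_)
    exact mul_le_mul (hCB z hz) (hCF _ (hy n)) (norm_nonneg _) ((norm_nonneg z).trans (hCB z hz))
  let K : Set (ℕ → ℝ) := closure (ev '' B)
  have : CompactSpace K := isCompact_iff_compactSpace.1 <|
    (isCompact_univ_pi fun _ => isCompact_Icc).of_isClosed_subset isClosed_closure hbox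
  let g : ℕ → C(K, ℝ) := fun n => ⟨fun x => x.1 n, (continuous_apply n).comp continuous_subtype_val⟩
  have hM : ∀ n x, g n x ∈ Set.Icc (-M) M := fun n x => hbox x.2 n trivial
  have hdense : Dense ((↑) ⁻¹' (ev '' B) : Set K) := by
    rw [Subtype.dense_iff, Subtype.image_preimage_coe,
      Set.inter_eq_right.2 subset_closure]
  obtain ⟨φ, hφ, f, hf⟩ := exists_subseq_tendsto_continuousMap hdense g M hM <| by
    intro u ψ x p c d hu hux hp hd hc
    choose z hz hzu using hu
    have hzg : ∀ j n, z j (y n) = g n (u j) := fun j n => congrFun (hzu j) n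
    refine h (y ∘ ψ) z (fun n => hy _) hz p (fun n => g (ψ n) x) d c (fun j => ?_) hd
      (fun n => ?_) hc
    · simpa only [Function.comp_apply, hzg] using hp j
    · simpa only [Function.comp_def, hzg] using ((g (ψ n)).continuous.tendsto x).comp hux
  have hrep : ∀ m, ∃ μ : ProbabilityMeasure K,
      ∀ n, ∫ x, g n x ∂(μ : Measure K) = ys m (y n) := by
    intro m
    refine convexHull_min (t := ev ⁻¹' _) ?_ ((convex_setOf_integral_eq g).linear_preimage ev)
      (hys m)
    intro z hz
    exact ⟨⟨Measure.dirac ⟨ev z, subset_closure ⟨z, hz, rfl⟩⟩, inferInstance⟩,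
      fun n => integral_dirac _ _⟩
  choose μ hμ using hrep
  refine iterated_integral_limits_eq (g ∘ φ) f M (fun n => hM _) hf μ a (b ∘ φ) L₁ L₂
    (fun m => ?_) hL₁ (fun n => ?_) (hL₂.comp hφ.tendsto_atTop)
  · simpa only [Function.comp_def, hμ] using (ha m).comp hφ.tendsto_atTop
  · simpa only [Function.comp_apply, hμ] using hb (φ n)

/-- the double limit condition passes from `A` to the absolutely
convex hull `aco(A) = co(A ∪ (−A))`. -/
theorem stmt1 {Y : Type*} [NormedAddCommGroup Y] [NormedSpace ℝ Y] [CompleteSpace Y]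
    (F : Set Y) (A : Set (Y →L[ℝ] ℝ))
    (hF : IsBounded F) (hA : IsBounded A)
    (h : DoubleLimitCond F A) :
    DoubleLimitCond F (aco A) := by
  exact h.union_neg.convexHull hF (hA.union hA.neg)
end
end

section
/- Let Y be a real Banach space, F ⊆ Y and A ⊆ Y* bounded sets. If A|_{cl_{w*}(F)} is relatively countably compact in C(cl_{w*}(F)) with the topology of pointwise convergence, then F|_{cl_{w*}(aco(A))} is relatively compact and relatively sequentially compact in C(cl_{w*}(aco(A))) with the topology of pointwise convergence. -/
open Filter Topology Metric Bornology

noncomputable section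

variable {X : Type*} [NormedAddCommGroup X] [NormedSpace ℝ X]

variable {Y : Type*} [NormedAddCommGroup Y] [NormedSpace ℝ Y]

/-- The space `C(K)` of pointwise-topology-continuous real functions on a subset
`K` of the dual, `K` carrying the weak* subspace topology. -/
def CK (K : Set (Y →L[ℝ] ℝ)) : Type _ :=
  {g : K → ℝ // @Continuous _ _ (subTop (wstarTop Y) K) _ g}

/-- `C(K)` carries the topology of pointwise convergence `τ_p`. -/
instance (K : Set (Y →L[ℝ] ℝ)) : TopologicalSpace (CK K) :=
  TopologicalSpace.induced (fun h : CK K => h.1) Pi.topologicalSpace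

/-- The set of restrictions `F|_K` of elements of `F ⊆ Y` to `K ⊆ Y*`,
viewed inside `C(K)`. -/
def resSet (F : Set Y) (K : Set (Y →L[ℝ] ℝ)) : Set (CK K) :=
  {h | ∃ f ∈ F, ∀ g : K, h.1 g = (g : Y →L[ℝ] ℝ) f}

/-- The positive linear functionals of norm at most one on `C(B, ℝ)`, as a subset of the product
space `C(B, ℝ) → ℝ`. -/
def subProbFunctionals (B : Type*) [TopologicalSpace B] : Set (C(B, ℝ) → ℝ) :=
  {Λ | (∀ g h, Λ (g + h) = Λ g + Λ h) ∧ (∀ (c : ℝ) g, Λ (c • g) = c * Λ g) ∧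
    (∀ g, 0 ≤ g → 0 ≤ Λ g) ∧ Λ 1 ≤ 1}

section Functionals

variable {B : Type*} [TopologicalSpace B]

lemma abs_le_norm_of_mem_subProbFunctionals [CompactSpace B] {Λ : C(B, ℝ) → ℝ}
    (hΛ : Λ ∈ subProbFunctionals B) (g : C(B, ℝ)) : |Λ g| ≤ ‖g‖ := by
  obtain ⟨hadd, hsmul, hpos, hone⟩ := hΛ
  have key : ∀ c : ℝ, |c| = 1 → c * Λ g ≤ ‖g‖ := by
    intro c hc
    have h0 : (0 : C(B, ℝ)) ≤ ‖g‖ • 1 + (-c) • g := by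
      intro x
      have h1 : |c * g x| ≤ ‖g‖ := by
        rw [abs_mul, hc, one_mul]
        exact g.norm_coe_le_norm x
      have h2 := (abs_le.mp h1).2
      change 0 ≤ ‖g‖ * 1 + -c * g x
      linarith
    have h1 := hpos _ h0
    rw [hadd, hsmul, hsmul] at h1
    have h2 : ‖g‖ * Λ 1 ≤ ‖g‖ := mul_le_of_le_one_right (norm_nonneg g) hone
    linarith
  rw [abs_le]
  constructor
  · linarith [key (-1) (by simp)]
  · linarith [key 1 (by simp)]

lemma isCompact_subProbFunctionals [CompactSpace B] : IsCompact (subProbFunctionals B) := by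
  refine (isCompact_univ_pi fun g : C(B, ℝ) => isCompact_Icc (a := -‖g‖) (b := ‖g‖)).of_isClosed_subset
    ?_ fun Λ hΛ g _ => abs_le.mp (abs_le_norm_of_mem_subProbFunctionals hΛ g)
  simp only [subProbFunctionals, Set.ofPred_and, Set.ofPred_forall]
  refine IsClosed.inter ?_ (IsClosed.inter ?_ (IsClosed.inter ?_ ?_))
  · exact isClosed_iInter fun g => isClosed_iInter fun h =>
      isClosed_eq (by fun_prop) (by fun_prop)
  · exact isClosed_iInter fun c => isClosed_iInter fun g =>
      isClosed_eq (by fun_prop) (by fun_prop)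
  · exact isClosed_iInter fun g => isClosed_iInter fun _ =>
      isClosed_le (by fun_prop) (by fun_prop)
  · exact isClosed_le (by fun_prop) (by fun_prop)

lemma exists_tendsto_of_mem_subProbFunctionals [CompactSpace B] {ι : Type*} (U : Ultrafilter ι)
    {Λ : ι → C(B, ℝ) → ℝ} (hΛ : ∀ i, Λ i ∈ subProbFunctionals B) :
    ∃ Λ' ∈ subProbFunctionals B, ∀ g, Tendsto (fun i => Λ i g) U (𝓝 (Λ' g)) := by
  obtain ⟨Λ', hΛ', hle⟩ := isCompact_subProbFunctionals.ultrafilter_le_nhds (U.map Λ)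
    (le_principal_iff.mpr (Filter.Eventually.of_forall (f := (U : Filter ι)) hΛ))
  exact ⟨Λ', hΛ', tendsto_pi_nhds.mp hle⟩

open MeasureTheory CompactlySupported in
lemma tendsto_of_mem_subProbFunctionals [CompactSpace B] [T2Space B] {Λ : C(B, ℝ) → ℝ}
    (hΛ : Λ ∈ subProbFunctionals B) {f : ℕ → C(B, ℝ)} {h : C(B, ℝ)} {M : ℝ}
    (hM : ∀ n x, |f n x| ≤ M) (hf : ∀ x, Tendsto (fun n => f n x) atTop (𝓝 (h x))) :
    Tendsto (fun n => Λ (f n)) atTop (𝓝 (Λ h)) := by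
  obtain ⟨hadd, hsmul, hpos, -⟩ := hΛ
  let _ : MeasurableSpace B := borel B
  have _ : BorelSpace B := ⟨rfl⟩
  let e : C(B, ℝ) ≃ C_c(B, ℝ) := CompactlySupportedContinuousMap.continuousMapEquiv
  let Λ₀ : C_c(B, ℝ) →ₗ[ℝ] ℝ :=
    { toFun := fun g => Λ (e.symm g)
      map_add' := fun g g' => hadd _ _
      map_smul' := fun c g => hsmul c _ }
  let Λ₁ : C_c(B, ℝ) →ₚ[ℝ] ℝ := PositiveLinearMap.mk₀ Λ₀ fun g hg => hpos _ hg
  have hint : ∀ g : C(B, ℝ), Λ g = ∫ x, g x ∂(RealRMK.rieszMeasure Λ₁) := fun g =>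
    (RealRMK.integral_rieszMeasure Λ₁ (e g)).symm
  simp only [hint]
  refine tendsto_integral_of_dominated_convergence (fun _ => M)
    (fun n => (f n).continuous.aestronglyMeasurable) (integrable_const M) (fun n => ?_) ?_
  · exact Filter.Eventually.of_forall fun x => hM n x
  · exact Filter.Eventually.of_forall hf

lemma eval_mem_subProbFunctionals (b : B) : (fun g : C(B, ℝ) => g b) ∈ subProbFunctionals B :=
  ⟨fun _ _ => rfl, fun _ _ => rfl, fun _ hg => hg b, le_rfl⟩

lemma zero_mem_subProbFunctionals : (fun _ : C(B, ℝ) => (0 : ℝ)) ∈ subProbFunctionals B :=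
  ⟨fun _ _ => by simp, fun _ _ => by simp, fun _ _ => le_rfl, zero_le_one⟩

lemma convex_subProbFunctionals : Convex ℝ (subProbFunctionals B) := by
  rintro Λ ⟨hadd, hsmul, hpos, hone⟩ Λ' ⟨hadd', hsmul', hpos', hone'⟩ s t hs ht hst
  refine ⟨fun g h => ?_, fun c g => ?_, fun g hg => ?_, ?_⟩
  · simp only [Pi.add_apply, Pi.smul_apply, smul_eq_mul, hadd, hadd']
    ring
  · simp only [Pi.add_apply, Pi.smul_apply, smul_eq_mul, hsmul, hsmul']
    ring
  · exact add_nonneg (mul_nonneg hs (hpos g hg)) (mul_nonneg ht (hpos' g hg))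
  · calc s * Λ 1 + t * Λ' 1 ≤ s * 1 + t * 1 := by gcongr
      _ = 1 := by linarith

end Functionals

section Krein

variable {W : Type*} [AddCommGroup W] [Module ℝ W] [TopologicalSpace W]

/-- Every point of the closed absolutely convex hull of a subset of a compact set `B` is represented
by a difference of two positive functionals on `C(B, ℝ)`. -/
lemma exists_subProbFunctionals_representing {A B : Set W} (hAB : A ⊆ B) (hB : IsCompact B)
    {x : W} (hx : x ∈ closure (convexHull ℝ (A ∪ -A))) :
    ∃ Λ₁ ∈ subProbFunctionals B, ∃ Λ₂ ∈ subProbFunctionals B, ∀ f : W →L[ℝ] ℝ,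
      f x = Λ₁ ⟨fun b : B => f b, by fun_prop⟩ - Λ₂ ⟨fun b : B => f b, by fun_prop⟩ := by
  have : CompactSpace B := isCompact_iff_compactSpace.mp hB
  let R : Set W := {x | ∃ Λ₁ ∈ subProbFunctionals B, ∃ Λ₂ ∈ subProbFunctionals B,
    ∀ f : W →L[ℝ] ℝ,
      f x = Λ₁ ⟨fun b : B => f b, by fun_prop⟩ - Λ₂ ⟨fun b : B => f b, by fun_prop⟩}
  have hRA : A ∪ -A ⊆ R := by
    rintro y (hy | hy)
    · exact ⟨_, eval_mem_subProbFunctionals ⟨y, hAB hy⟩, _, zero_mem_subProbFunctionals,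
        fun f => by simp⟩
    · exact ⟨_, zero_mem_subProbFunctionals, _, eval_mem_subProbFunctionals ⟨-y, hAB hy⟩,
        fun f => by simp⟩
  have hRconv : Convex ℝ R := by
    rintro y ⟨Λ₁, h₁, Λ₂, h₂, hy⟩ z ⟨Γ₁, g₁, Γ₂, g₂, hz⟩ s t hs ht hst
    refine ⟨_, convex_subProbFunctionals h₁ g₁ hs ht hst, _,
      convex_subProbFunctionals h₂ g₂ hs ht hst, fun f => ?_⟩
    simp only [map_add, map_smul, hy, hz, Pi.add_apply, Pi.smul_apply, smul_eq_mul]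
    ring
  have hne := mem_closure_iff_comap_neBot.mp (closure_mono (convexHull_min hRA hRconv) hx)
  let U : Ultrafilter R := Ultrafilter.of (comap (↑) (𝓝 x))
  have hU : Tendsto ((↑) : R → W) U (𝓝 x) :=
    tendsto_comap.mono_left (Ultrafilter.of_le (comap ((↑) : R → W) (𝓝 x)))
  choose Λ₁ h₁ Λ₂ h₂ hrep using fun y : R => y.2
  obtain ⟨Γ₁, g₁, ht₁⟩ := exists_tendsto_of_mem_subProbFunctionals U h₁
  obtain ⟨Γ₂, g₂, ht₂⟩ := exists_tendsto_of_mem_subProbFunctionals U h₂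
  refine ⟨Γ₁, g₁, Γ₂, g₂, fun f => tendsto_nhds_unique (f.continuous.continuousAt.tendsto.comp hU)
    (((ht₁ _).sub (ht₂ _)).congr fun y => (hrep y f).symm)⟩

/-- Pointwise convergence on a compact set, to a continuous limit, of a bounded sequence of
continuous linear functionals passes to the closed absolutely convex hull. -/
lemma exists_continuous_limit_on_closure_convexHull [T2Space W] {A B : Set W} (hAB : A ⊆ B)
    (hB : IsCompact B) {f : ℕ → W →L[ℝ] ℝ} {h : C(B, ℝ)} {M : ℝ}
    (hM : ∀ n, ∀ x ∈ B, |f n x| ≤ M)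
    (hf : ∀ x : B, Tendsto (fun n => f n x) atTop (𝓝 (h x))) :
    ∃ H : C(closure (convexHull ℝ (A ∪ -A)), ℝ),
      ∀ x : closure (convexHull ℝ (A ∪ -A)), Tendsto (fun n => f n x) atTop (𝓝 (H x)) := by
  have : CompactSpace B := isCompact_iff_compactSpace.mp hB
  have hlim : ∀ Λ₁ ∈ subProbFunctionals B, ∀ Λ₂ ∈ subProbFunctionals B, ∀ x,
      (∀ g : W →L[ℝ] ℝ,
        g x = Λ₁ ⟨fun b : B => g b, by fun_prop⟩ - Λ₂ ⟨fun b : B => g b, by fun_prop⟩) →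
      Tendsto (fun n => f n x) atTop (𝓝 (Λ₁ h - Λ₂ h)) := by
    intro Λ₁ h₁ Λ₂ h₂ x hx
    simp only [hx]
    exact (tendsto_of_mem_subProbFunctionals h₁ (fun n x => hM n x x.2) hf).sub
      (tendsto_of_mem_subProbFunctionals h₂ (fun n x => hM n x x.2) hf)
  choose Λ₁ h₁ Λ₂ h₂ hrep using fun x : closure (convexHull ℝ (A ∪ -A)) =>
    exists_subProbFunctionals_representing hAB hB x.2
  refine ⟨⟨fun x => Λ₁ x h - Λ₂ x h, ?_⟩, fun x => hlim _ (h₁ x) _ (h₂ x) x (hrep x)⟩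
  refine continuous_iff_ultrafilter.mpr fun x U hU => ?_
  obtain ⟨Γ₁, g₁, ht₁⟩ := exists_tendsto_of_mem_subProbFunctionals U h₁
  obtain ⟨Γ₂, g₂, ht₂⟩ := exists_tendsto_of_mem_subProbFunctionals U h₂
  have hx : Tendsto (fun n => f n x) atTop (𝓝 (Γ₁ h - Γ₂ h)) := by
    refine hlim _ g₁ _ g₂ x fun g => tendsto_nhds_unique ?_
      (((ht₁ _).sub (ht₂ _)).congr fun y => (hrep y g).symm)
    exact (g.continuous.comp continuous_subtype_val).continuousAt.tendsto.mono_left hU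
  rw [tendsto_nhds_unique (hlim _ (h₁ x) _ (h₂ x) x (hrep x)) hx]
  exact (ht₁ h).sub (ht₂ h)

end Krein

section DoubleLimit

lemma eq_of_mapClusterPt_of_tendsto {α Z : Type*} [TopologicalSpace Z] [T2Space Z] {l : Filter α}
    {u : α → Z} {x y : Z} (hx : MapClusterPt x l u) (hy : Tendsto u l (𝓝 y)) : x = y :=
  eq_of_nhds_neBot (NeBot.mono hx (inf_le_inf_left _ hy))

lemma exists_tendsto_of_abs_le {ι : Type*} (U : Ultrafilter ι) {c : ι → ℝ} {M : ℝ}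
    (hM : ∀ i, |c i| ≤ M) : ∃ l, Tendsto c U (𝓝 l) := by
  obtain ⟨l, -, hl⟩ := (isCompact_Icc (a := -M) (b := M)).ultrafilter_le_nhds (U.map c)
    (le_principal_iff.mpr
      (Filter.Eventually.of_forall (f := (U : Filter ι)) fun i => abs_le.mp (hM i)))
  exact ⟨l, hl⟩

lemma exists_tendsto_of_ultrafilter_limits_eq {ι : Type*} {l : Filter ι} [l.NeBot] {c : ι → ℝ}
    {M : ℝ} (hM : ∀ i, |c i| ≤ M)
    (h : ∀ U V : Ultrafilter ι, ↑U ≤ l → ↑V ≤ l → ∀ α β, Tendsto c U (𝓝 α) →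
      Tendsto c V (𝓝 β) → α = β) :
    ∃ x, Tendsto c l (𝓝 x) := by
  obtain ⟨x, hx⟩ := exists_tendsto_of_abs_le (Ultrafilter.of l) hM
  refine ⟨x, (tendsto_iff_ultrafilter _ _ _).mpr fun V hV => ?_⟩
  obtain ⟨y, hy⟩ := exists_tendsto_of_abs_le V hM
  rwa [h _ V (Ultrafilter.of_le l) hV x y hx hy]

/-- Grothendieck's interchange of double limits for a sequence of functions `f` and sequences in
`A`, where the limits of `f` are taken along two ultrafilters simultaneously. -/
def InterchangesDoubleLimits {B : Type*} (f : ℕ → B → ℝ) (A : Set B) : Prop :=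
  ∀ a : ℕ → B, (∀ m, a m ∈ A) →
    ∀ c : ℕ → ℝ, (∀ n, Tendsto (fun m => f n (a m)) atTop (𝓝 (c n))) →
    ∀ (U V : Ultrafilter ℕ) (p q : ℕ → ℝ), (∀ m, Tendsto (fun n => f n (a m)) U (𝓝 (p m))) →
      (∀ m, Tendsto (fun n => f n (a m)) V (𝓝 (q m))) →
    ∀ α β, Tendsto c U (𝓝 α) → Tendsto c V (𝓝 β) → MapClusterPt (α, β) atTop fun m => (p m, q m)

variable {B : Type*} [TopologicalSpace B]

lemma exists_subseq_tendsto_continuous {A : Set B} (hA : Dense A) {f : ℕ → B → ℝ}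
    (hf : ∀ n, Continuous (f n)) {M : ℝ} (hM : ∀ n x, |f n x| ≤ M)
    (hDL : ∀ φ : ℕ → ℕ, InterchangesDoubleLimits (f ∘ φ) A) :
    ∃ φ : ℕ → ℕ, StrictMono φ ∧ ∃ h : C(B, ℝ),
      ∀ x, Tendsto (fun k => f (φ k) x) atTop (𝓝 (h x)) := by
  set T : B → ℕ → ℝ := fun x n => f n x
  have hT : Continuous T := by fun_prop
  obtain ⟨D, hDA, hDc, hD⟩ :=
    (TopologicalSpace.IsSeparable.of_separableSpace (T '' A)).exists_countable_dense_subset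
  have : Countable D := hDc.to_subtype
  choose s hsA hs using hDA
  have hDbdd : ∀ (d : D) n, |(d : ℕ → ℝ) n| ≤ M := fun d n => by
    rw [← hs d.2]
    exact hM n _
  obtain ⟨ℓ, -, φ, hφ, hℓ⟩ := (isCompact_univ_pi fun _ : D =>
    isCompact_Icc (a := -M) (b := M)).tendsto_subseq (x := fun n (d : D) => (d : ℕ → ℝ) n)
    fun n d _ => abs_le.mp (hDbdd d n)
  rw [tendsto_pi_nhds] at hℓ
  have hTD : ∀ x, T x ∈ closure D := fun x =>
    closure_minimal hD isClosed_closure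
      (image_closure_subset_closure_image hT ⟨x, hA x, rfl⟩)
  have hconv : ∀ x, ∃ l, Tendsto (fun k => f (φ k) x) atTop (𝓝 l) := by
    intro x
    obtain ⟨d, hd, hdx⟩ := mem_closure_iff_seq_limit.mp (hTD x)
    refine exists_tendsto_of_ultrafilter_limits_eq (fun k => hM (φ k) x)
      fun U V hU hV α β hα hβ => ?_
    have hlim : ∀ m, Tendsto (fun k => f (φ k) (s (hd m))) atTop (𝓝 (ℓ ⟨d m, hd m⟩)) := by
      intro m
      have := hℓ ⟨d m, hd m⟩
      refine this.congr fun k => ?_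
      exact (congrFun (hs (hd m)) (φ k)).symm
    have hcl := hDL φ (fun m => s (hd m)) (fun m => hsA (hd m)) (fun k => f (φ k) x)
      (fun k => ((tendsto_pi_nhds.mp hdx) (φ k)).congr fun m =>
        (congrFun (hs (hd m)) (φ k)).symm) U V _ _
      (fun m => (hlim m).mono_left hU) (fun m => (hlim m).mono_left hV) α β hα hβ
    exact isClosed_diagonal.mem_of_mapClusterPt hcl (Filter.Eventually.of_forall fun _ => rfl)
  choose h hh using hconv
  have hext : ∀ x, Tendsto (fun a : A => h a) (comap (↑) (𝓝 x)) (𝓝 (h x)) := by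
    intro x
    have hle : comap ((↑) : A → B) (𝓝 x) ≤ comap (fun a : A => T a) (𝓝 (T x)) := by
      rw [show (fun a : A => T a) = T ∘ (↑) from rfl, ← comap_comap]
      exact comap_mono hT.continuousAt.le_comap
    refine Tendsto.mono_left ?_ hle
    refine tendsto_of_subseq_tendsto fun a ha => ?_
    have hat : Tendsto (fun m => T (a m)) atTop (𝓝 (T x)) := tendsto_comap_iff.mp ha
    let U : Ultrafilter ℕ := Ultrafilter.of atTop
    have hU : ↑U ≤ (atTop : Filter ℕ) := Ultrafilter.of_le _
    have hcl := hDL φ (fun m => a m) (fun m => (a m).2) (fun k => f (φ k) x)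
      (fun k => (tendsto_pi_nhds.mp hat) (φ k)) U U (fun m => h (a m)) (fun m => h (a m))
      (fun m => (hh _).mono_left hU) (fun m => (hh _).mono_left hU) _ _
      ((hh x).mono_left hU) ((hh x).mono_left hU)
    obtain ⟨ψ, -, hψ⟩ := (hcl.continuousAt_comp
      continuous_fst.continuousAt).tendsto_subseq
    exact ⟨ψ, hψ⟩
  have hden : IsDenseInducing ((↑) : A → B) := hA.isDenseInducing_val
  have hcont := hden.continuous_extend fun x => ⟨h x, hext x⟩
  refine ⟨φ, hφ, ⟨h, ?_⟩, hh⟩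
  convert hcont using 1
  funext x
  exact (hden.extend_eq_of_tendsto (hext x)).symm

/-- A pointwise limit of continuous functions on a compact space is continuous if every sequence of
these functions has a subsequence converging pointwise to a continuous function. -/
lemma continuous_of_mem_closure_range {L ι : Type*} [TopologicalSpace L] [CompactSpace L]
    {f : ι → L → ℝ} (hf : ∀ i, Continuous (f i))
    (hseq : ∀ u : ℕ → ι, ∃ φ : ℕ → ℕ, StrictMono φ ∧ ∃ h : C(L, ℝ),
      ∀ x, Tendsto (fun k => f (u (φ k)) x) atTop (𝓝 (h x)))
    {θ : L → ℝ} (hθ : θ ∈ closure (Set.range f)) : Continuous θ := by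
  have happrox : ∀ (s : Finset L) (ε : ℝ), 0 < ε → ∃ i, ∀ x ∈ s, |f i x - θ x| < ε := by
    intro s ε hε
    have hU : {g : L → ℝ | ∀ x ∈ s, |g x - θ x| < ε} ∈ 𝓝 θ := by
      refine (Filter.eventually_all_finset s).mpr fun x _ => ?_
      have hc : Continuous fun g : L → ℝ => |g x - θ x| := by fun_prop
      exact hc.continuousAt.eventually_lt continuousAt_const (by simpa using hε)
    obtain ⟨_, hg, i, rfl⟩ := mem_closure_iff_nhds.mp hθ _ hU
    exact ⟨i, hg⟩
  by_contra hcon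
  simp only [continuous_iff_continuousAt, not_forall] at hcon
  obtain ⟨x₀, hx₀⟩ := hcon
  rw [ContinuousAt, Metric.tendsto_nhds] at hx₀
  push Not at hx₀
  obtain ⟨ε, hε, hfreq⟩ := hx₀
  obtain ⟨s, hsP, hsr⟩ := exists_seq_of_forall_finset_exists
    (fun p : ι × L × ℕ => |f p.1 x₀ - θ x₀| < 1 / ((p.2.2 : ℝ) + 1) ∧ ε ≤ dist (θ p.2.1) (θ x₀))
    (fun p q => p.2.2 < q.2.2 ∧ |f q.1 p.2.1 - θ p.2.1| < 1 / ((q.2.2 : ℝ) + 1) ∧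
      |f p.1 q.2.1 - f p.1 x₀| < 1 / ((q.2.2 : ℝ) + 1)) (by
    classical
    intro t _
    obtain ⟨n, hn⟩ : ∃ n : ℕ, ∀ p ∈ t, p.2.2 < n :=
      ⟨t.sup (fun p => p.2.2) + 1, fun p hp =>
        Nat.lt_succ_of_le (Finset.le_sup (f := fun p : ι × L × ℕ => p.2.2) hp)⟩
    have hpos : (0 : ℝ) < 1 / ((n : ℝ) + 1) := by positivity
    obtain ⟨i, hi⟩ := happrox (insert x₀ (t.image fun p => p.2.1)) _ hpos
    have hnear : ∀ᶠ x in 𝓝 x₀, ∀ p ∈ t, |f p.1 x - f p.1 x₀| < 1 / ((n : ℝ) + 1) := by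
      refine (Filter.eventually_all_finset t).mpr fun p _ => ?_
      have hc : Continuous fun x => |f p.1 x - f p.1 x₀| := by
        have := hf p.1
        fun_prop
      exact hc.continuousAt.eventually_lt continuousAt_const (by simpa using hpos)
    obtain ⟨x, hxε, hx⟩ := (hfreq.and_eventually hnear).exists
    exact ⟨(i, x, n), ⟨hi _ (Finset.mem_insert_self _ _), hxε⟩, fun p hp => ⟨hn p hp,
      hi _ (Finset.mem_insert_of_mem (Finset.mem_image_of_mem _ hp)), hx p hp⟩⟩)
  have hmono : StrictMono fun n => (s n).2.2 := fun m n hmn => (hsr m n hmn).1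
  have hzero : Tendsto (fun n => 1 / (((s n).2.2 : ℝ) + 1)) atTop (𝓝 0) :=
    tendsto_one_div_add_atTop_nhds_zero_nat.comp hmono.tendsto_atTop
  have hsqueeze : ∀ (g : ℕ → ℝ) (l : ℝ),
      (∀ᶠ n in atTop, |g n - l| < 1 / (((s n).2.2 : ℝ) + 1)) → Tendsto g atTop (𝓝 l) := by
    intro g l hg
    rw [tendsto_iff_dist_tendsto_zero]
    exact squeeze_zero' (Filter.Eventually.of_forall fun _ => dist_nonneg)
      (hg.mono fun n hn => hn.le) hzero
  obtain ⟨φ, hφ, h, hh⟩ := hseq fun n => (s n).1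
  have hx₀' : h x₀ = θ x₀ := tendsto_nhds_unique (hh x₀)
    ((hsqueeze _ _ (Filter.Eventually.of_forall fun n => (hsP n).1)).comp hφ.tendsto_atTop)
  have hxm : ∀ m, h (s m).2.1 = θ (s m).2.1 := fun m => tendsto_nhds_unique (hh _)
    ((hsqueeze _ _ ((eventually_gt_atTop m).mono fun n hn => (hsr m n hn).2.1)).comp
      hφ.tendsto_atTop)
  obtain ⟨x, -, hx⟩ := isCompact_univ.exists_mapClusterPt (f := (atTop : Filter ℕ))
    (u := fun n => (s n).2.1) (by simp)
  have hfx : ∀ m, f (s m).1 x = f (s m).1 x₀ := fun m =>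
    (eq_of_mapClusterPt_of_tendsto (hx.continuousAt_comp (hf (s m).1).continuousAt)
      (hsqueeze _ _ ((eventually_gt_atTop m).mono fun n hn => (hsr m n hn).2.2)))
  have hhx : h x = h x₀ := tendsto_nhds_unique ((hh x).congr fun k => hfx (φ k)) (hh x₀)
  have hmem : h x ∈ {y | ε ≤ dist y (θ x₀)} :=
    IsClosed.mem_of_mapClusterPt (isClosed_le continuous_const (by fun_prop))
      (hx.continuousAt_comp h.continuous.continuousAt)
      (Filter.Eventually.of_forall fun n => by
        have := (hsP n).2
        rwa [← hxm n] at this)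
  rw [Set.mem_ofPred_eq, hhx, hx₀', dist_self] at hmem
  exact absurd hmem (not_le.mpr hε)

end DoubleLimit

section WeakStar

variable {E : Type*} [NormedAddCommGroup E] [NormedSpace ℝ E]

lemma isCompact_closure_weakDual {s : Set (WeakDual ℝ E)}
    (hs : IsBounded (WeakDual.toStrongDual '' s)) : IsCompact (closure s) := by
  obtain ⟨R, hR⟩ := hs.subset_closedBall 0
  refine (WeakDual.isCompact_closedBall (𝕜 := ℝ) (E := E) 0 R).of_isClosed_subset isClosed_closure
    (closure_minimal ?_ (WeakDual.isClosed_closedBall 0 R))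
  exact fun x hx => hR ⟨x, hx, rfl⟩

lemma tendsto_nhds_subTop_wstarTop {α : Type*} {l : Filter α} {K : Set (E →L[ℝ] ℝ)} {u : α → K}
    {φ : K} : Tendsto u l (@nhds _ (subTop (wstarTop E) K) φ) ↔
      ∀ x : E, Tendsto (fun i => (u i : E →L[ℝ] ℝ) x) l (𝓝 ((φ : E →L[ℝ] ℝ) x)) := by
  unfold subTop wstarTop
  rw [induced_compose, nhds_induced, tendsto_comap_iff, tendsto_pi_nhds]
  rfl

lemma interchangesDoubleLimits_of_mapClusterPt {F : Set E} {A : Set (E →L[ℝ] ℝ)} (hF : IsBounded F)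
    {K : Set ((E →L[ℝ] ℝ) →L[ℝ] ℝ)}
    (hK : K = wstarClosure (NormedSpace.inclusionInDoubleDual ℝ E '' F))
    (hcc : ∀ a : ℕ → (E →L[ℝ] ℝ), (∀ m, a m ∈ A) →
      ∃ g : K → ℝ, @Continuous _ _ (subTop (wstarTop (E →L[ℝ] ℝ)) K) _ g ∧
        MapClusterPt g atTop (fun m => fun φ : K => (φ : (E →L[ℝ] ℝ) →L[ℝ] ℝ) (a m)))
    {f : ℕ → E} (hf : ∀ n, f n ∈ F) :
    InterchangesDoubleLimits (fun n (x : E →L[ℝ] ℝ) => x (f n)) A := by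
  intro a ha c hc U V p q hp hq α β hα hβ
  obtain ⟨g, hg, hcl⟩ := hcc a ha
  have hfK : ∀ n, NormedSpace.inclusionInDoubleDual ℝ E (f n) ∈ K := fun n => by
    rw [hK]
    exact @subset_closure _ (wstarTop _) _ _ ⟨f n, hf n, rfl⟩
  have hgc : ∀ n, g ⟨_, hfK n⟩ = c n := fun n =>
    eq_of_mapClusterPt_of_tendsto
      (hcl.continuousAt_comp
        (f := fun k : K → ℝ => k ⟨_, hfK n⟩) (continuous_apply _).continuousAt) (hc n)
  have hKc : IsCompact (X := WeakDual ℝ (E →L[ℝ] ℝ)) K := by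
    rw [hK]
    refine isCompact_closure_weakDual (E := E →L[ℝ] ℝ) ?_
    obtain ⟨R, hR⟩ := hF.exists_norm_le
    refine isBounded_iff_forall_norm_le.mpr ⟨R, ?_⟩
    rintro _ ⟨_, ⟨y, hy, rfl⟩, rfl⟩
    exact (NormedSpace.double_dual_bound ℝ E y).trans (hR y hy)
  have hex : ∀ (U : Ultrafilter ℕ) (p : ℕ → ℝ) (α : ℝ),
      (∀ m, Tendsto (fun n => a m (f n)) U (𝓝 (p m))) → Tendsto c U (𝓝 α) →
      ∃ φ : K, (∀ m, (φ : (E →L[ℝ] ℝ) →L[ℝ] ℝ) (a m) = p m) ∧ g φ = α := by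
    intro U p α hp hα
    obtain ⟨φ, hφK, hφ⟩ := hKc.ultrafilter_le_nhds
      (U.map fun n => (NormedSpace.inclusionInDoubleDual ℝ E (f n) : WeakDual ℝ (E →L[ℝ] ℝ)))
      (le_principal_iff.mpr (Filter.Eventually.of_forall (f := (U : Filter ℕ)) hfK))
    have hev : ∀ x : E →L[ℝ] ℝ, Tendsto (fun n => x (f n)) U (𝓝 (φ x)) := fun x =>
      ((WeakDual.eval_continuous x).tendsto φ).comp hφ
    refine ⟨⟨φ, hφK⟩, fun m => tendsto_nhds_unique (hev _) (hp m), ?_⟩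
    have hlim := tendsto_nhds_subTop_wstarTop (u := fun n => (⟨_, hfK n⟩ : K)) (φ := ⟨φ, hφK⟩)
      (l := (U : Filter ℕ)) |>.mpr hev
    have hgt := (@Continuous.tendsto _ _ (subTop (wstarTop (E →L[ℝ] ℝ)) K) _ g hg ⟨φ, hφK⟩).comp hlim
    exact tendsto_nhds_unique hgt (hα.congr fun n => (hgc n).symm)
  obtain ⟨φ, hφ, rfl⟩ := hex U p α hp hα
  obtain ⟨ψ, hψ, rfl⟩ := hex V q β hq hβ
  have hpair : Continuous fun k : K → ℝ => (k φ, k ψ) := by fun_prop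
  simpa only [Function.comp_def, hφ, hψ] using hcl.continuousAt_comp hpair.continuousAt

lemma exists_closure_aco_subset_closedBall {A : Set (E →L[ℝ] ℝ)} (hA : IsBounded A) :
    ∃ R, wstarClosure (aco A) ⊆ closedBall 0 R := by
  obtain ⟨R, hR⟩ := hA.exists_norm_le
  refine ⟨R, closure_minimal (X := WeakDual ℝ E) ?_ (WeakDual.isClosed_closedBall 0 _)⟩
  refine convexHull_min ?_ (convex_closedBall (0 : E →L[ℝ] ℝ) _)
  rintro z (hz | hz)
  · exact mem_closedBall_zero_iff.mpr (hR z hz)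
  · exact mem_closedBall_zero_iff.mpr (norm_neg z ▸ hR _ hz)

lemma compactSpace_closure_aco {A : Set (E →L[ℝ] ℝ)} (hA : IsBounded A) :
    @CompactSpace (wstarClosure (aco A)) (subTop (wstarTop E) (wstarClosure (aco A))) := by
  obtain ⟨R, hR⟩ := exists_closure_aco_subset_closedBall hA
  exact (@isCompact_iff_compactSpace (E →L[ℝ] ℝ) (wstarTop E) _).mp
    ((WeakDual.isCompact_closedBall (𝕜 := ℝ) (E := E) 0 R).of_isClosed_subset
      isClosed_closure hR)

lemma exists_bound_on_closure_aco {F : Set E} {A : Set (E →L[ℝ] ℝ)} (hF : IsBounded F)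
    (hA : IsBounded A) : ∃ M, ∀ x ∈ wstarClosure (aco A), ∀ y ∈ F, |x y| ≤ M := by
  obtain ⟨R, hR⟩ := hF.exists_norm_le
  obtain ⟨S, hS⟩ := exists_closure_aco_subset_closedBall hA
  refine ⟨S * R, fun x hx y hy => ?_⟩
  have hxS : ‖x‖ ≤ S := mem_closedBall_zero_iff.mp (hS hx)
  exact (x.le_opNorm y).trans
    (mul_le_mul hxS (hR y hy) (norm_nonneg _) ((norm_nonneg x).trans hxS))

lemma continuous_subTop_eval (K : Set (E →L[ℝ] ℝ)) (y : E) :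
    @Continuous _ _ (subTop (wstarTop E) K) _ fun x : K => (x : E →L[ℝ] ℝ) y := by
  unfold subTop wstarTop
  rw [induced_compose]
  exact @Continuous.comp _ _ _ (_) _ _ _ _ (continuous_apply y) continuous_induced_dom

lemma exists_subseq_tendsto_on_closure_aco {F : Set E} {A : Set (E →L[ℝ] ℝ)} (hF : IsBounded F)
    (hA : IsBounded A) {K : Set ((E →L[ℝ] ℝ) →L[ℝ] ℝ)}
    (hK : K = wstarClosure (NormedSpace.inclusionInDoubleDual ℝ E '' F))
    (hcc : ∀ a : ℕ → (E →L[ℝ] ℝ), (∀ m, a m ∈ A) →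
      ∃ g : K → ℝ, @Continuous _ _ (subTop (wstarTop (E →L[ℝ] ℝ)) K) _ g ∧
        MapClusterPt g atTop (fun m => fun φ : K => (φ : (E →L[ℝ] ℝ) →L[ℝ] ℝ) (a m)))
    {f : ℕ → E} (hf : ∀ n, f n ∈ F) :
    ∃ φ : ℕ → ℕ, StrictMono φ ∧ ∃ h : CK (wstarClosure (aco A)),
      ∀ x : wstarClosure (aco A),
        Tendsto (fun k => (x : E →L[ℝ] ℝ) (f (φ k))) atTop (𝓝 (h.1 x)) := by
  obtain ⟨M, hM⟩ := exists_bound_on_closure_aco hF hA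
  let A' : Set (WeakDual ℝ E) := A
  let e : E → WeakDual ℝ E →L[ℝ] ℝ := WeakBilin.eval (topDualPairing ℝ E)
  have hAB : A' ⊆ closure A' := subset_closure
  have hsub : closure A' ⊆ wstarClosure (aco A) :=
    closure_mono (X := WeakDual ℝ E) (Set.subset_union_left.trans (subset_convexHull ℝ (A ∪ -A)))
  have hdense : Dense ((↑) ⁻¹' A' : Set (closure A')) := by
    rw [Subtype.dense_iff, Subtype.image_preimage_coe, Set.inter_eq_right.mpr hAB]
  obtain ⟨φ, hφ, h, hh⟩ := exists_subseq_tendsto_continuous hdense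
    (f := fun n (x : closure A') => e (f n) x) (fun n => by fun_prop) (M := M)
    (fun n x => hM (x : WeakDual ℝ E) (hsub x.2) _ (hf n))
    (fun ψ a ha => interchangesDoubleLimits_of_mapClusterPt hF hK hcc (fun n => hf (ψ n))
      (fun m => (a m : WeakDual ℝ E)) ha)
  obtain ⟨H, hH⟩ := exists_continuous_limit_on_closure_convexHull hAB
    (isCompact_closure_weakDual (hA.subset (by rintro _ ⟨x, hx, rfl⟩; exact hx)))
    (f := fun n => e (f (φ n))) (M := M) (fun n x hx => hM x (hsub hx) _ (hf _)) hh
  exact ⟨φ, hφ, ⟨H, H.continuous⟩, hH⟩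

end WeakStar

/-- if `A|_{cl_w*(F)}` is relatively countably compact in
`(C(cl_w*(F)), τ_p)`, then `F|_{cl_w*(aco A)}` is relatively compact and
relatively sequentially compact in `(C(cl_w*(aco A)), τ_p)`. -/
theorem stmt2 [CompleteSpace Y]
    (F : Set Y) (A : Set (Y →L[ℝ] ℝ))
    (hF : IsBounded F) (hA : IsBounded A)
    (K : Set ((Y →L[ℝ] ℝ) →L[ℝ] ℝ))
    (hK : K = @closure _ (wstarTop (Y →L[ℝ] ℝ)) ((NormedSpace.inclusionInDoubleDual ℝ Y) '' F))
    -- relative countable compactness of `A|_K` in `(C(K), τ_p)`: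
    (hcc : ∀ a : ℕ → (Y →L[ℝ] ℝ), (∀ m, a m ∈ A) →
      ∃ g : K → ℝ, @Continuous _ _ (subTop (wstarTop (Y →L[ℝ] ℝ)) K) _ g ∧
        MapClusterPt g atTop (fun m => fun φ : K => (φ : (Y →L[ℝ] ℝ) →L[ℝ] ℝ) (a m))) :
    -- relative compactness of `F|_{cl_w*(aco A)}`:
    IsCompact (closure (resSet F (wstarClosure (aco A)))) ∧
    -- relative sequential compactness of `F|_{cl_w*(aco A)}`:
    (∀ u : ℕ → CK (wstarClosure (aco A)), (∀ n, u n ∈ resSet F (wstarClosure (aco A))) →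
      ∃ (h : CK (wstarClosure (aco A))) (φ : ℕ → ℕ), StrictMono φ ∧
        Tendsto (u ∘ φ) atTop (𝓝 h)) := by
  obtain ⟨M, hM⟩ := exists_bound_on_closure_aco hF hA
  have hind : IsInducing fun h : CK (wstarClosure (aco A)) => h.1 := ⟨rfl⟩
  let r : F → CK (wstarClosure (aco A)) := fun y =>
    ⟨fun x => (x : Y →L[ℝ] ℝ) y, continuous_subTop_eval _ _⟩
  have hr : resSet F (wstarClosure (aco A)) = Set.range r := by
    ext h
    constructor
    · rintro ⟨y, hy, hyh⟩
      exact ⟨⟨y, hy⟩, Subtype.ext (funext fun x => (hyh x).symm)⟩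
    · rintro ⟨y, rfl⟩
      exact ⟨y, y.2, fun _ => rfl⟩
  have hseq : ∀ u : ℕ → F, ∃ φ : ℕ → ℕ, StrictMono φ ∧ ∃ h : CK (wstarClosure (aco A)),
      ∀ x, Tendsto (fun k => (r (u (φ k))).1 x) atTop (𝓝 (h.1 x)) := fun u =>
    exists_subseq_tendsto_on_closure_aco hF hA hK hcc fun n => (u n).2
  rw [hr]
  constructor
  · rw [hind.closure_eq_preimage_closure_image, hind.isCompact_preimage_iff]
    · refine (isCompact_univ_pi fun _ => isCompact_Icc (a := -M) (b := M)).of_isClosed_subset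
        isClosed_closure (closure_minimal ?_ (isClosed_set_pi fun _ _ => isClosed_Icc))
      rintro _ ⟨_, ⟨y, rfl⟩, rfl⟩ x -
      exact abs_le.mp (hM x x.2 y y.2)
    · intro θ hθ
      rw [← Set.range_comp] at hθ
      let t : TopologicalSpace (wstarClosure (aco A)) := subTop (wstarTop Y) (wstarClosure (aco A))
      have hLt : @CompactSpace (wstarClosure (aco A)) t := compactSpace_closure_aco hA
      have hcont : @Continuous _ _ t _ θ :=
        @continuous_of_mem_closure_range _ _ t hLt _ (fun y => (r y).2)
          (fun u => by
            obtain ⟨φ, hφ, h, hh⟩ := hseq u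
            exact ⟨φ, hφ, @ContinuousMap.mk _ _ t _ h.1 h.2, hh⟩) _ hθ
      exact ⟨⟨θ, hcont⟩, rfl⟩
  · intro u hu
    choose v hv using hu
    obtain ⟨φ, hφ, h, hh⟩ := hseq v
    refine ⟨h, φ, hφ, hind.tendsto_nhds_iff.mpr (tendsto_pi_nhds.mpr fun x => ?_)⟩
    simpa only [Function.comp_apply, hv] using hh x
end
end

section
/- Let Y be a real Banach space, F ⊆ Y a bounded set, and A ⊆ Y* a bounded set that is norming for Y. If A|_{cl_{w*}(F)} is relatively countably compact in C(cl_{w*}(F)) with the pointwise topology, then F is relatively weakly compact in Y. -/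
open Filter Topology Metric Bornology

noncomputable section

variable {X : Type*} [NormedAddCommGroup X] [NormedSpace ℝ X]

open scoped CompactlySupported in
/-- If a uniformly bounded sequence of continuous functions on a compact space tends pointwise to
zero, then every convex set containing it has elements that are uniformly small from above. -/
theorem exists_mem_lt_of_tendsto_zero {T : Type*} [TopologicalSpace T] [CompactSpace T] [T2Space T]
    {C : Set C(T, ℝ)} (hC : Convex ℝ C) {g : ℕ → C(T, ℝ)} (hg : ∀ i, g i ∈ C) {M : ℝ}
    (hM : ∀ i x, |g i x| ≤ M) (hlim : ∀ x, Tendsto (fun i => g i x) atTop (𝓝 0))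
    {ε : ℝ} (hε : 0 < ε) : ∃ c ∈ C, ∀ x, c x < ε := by
  by_contra! hne
  let U : Set C(T, ℝ) := {u | ∀ x, u x < ε}
  have hUo : IsOpen U := by
    simpa [U, Set.MapsTo] using
      ContinuousMap.isOpen_setOfPred_mapsTo (X := T) (Y := ℝ) isCompact_univ (isOpen_Iio (a := ε))
  have hUc : Convex ℝ U := fun u hu v hv a b ha hb hab x =>
    convex_Iio ε (hu x) (hv x) ha hb hab
  have hdisj : Disjoint U C := by
    rw [Set.disjoint_left]
    intro u hu hc
    obtain ⟨x, hx⟩ := hne u hc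
    exact (hu x).not_ge hx
  obtain ⟨L, s, hLU, hLC⟩ := geometric_hahn_banach_open hUc hUo hC hdisj
  have hs : 0 < s := by
    have := hLU 0 (fun x => by simpa using hε)
    simpa using this
  have hpos : ∀ v : C(T, ℝ), (∀ x, 0 ≤ v x) → 0 ≤ L v := by
    intro v hv
    by_contra! hneg
    have ht : 0 ≤ s / -L v := by
      have : 0 < -L v := by linarith
      positivity
    have h := hLU (-((s / -L v) • v)) (fun x => by
      have := mul_nonneg ht (hv x)
      simp only [ContinuousMap.coe_neg, ContinuousMap.coe_smul, Pi.neg_apply, Pi.smul_apply,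
        smul_eq_mul]
      linarith)
    rw [map_neg, map_smul, smul_eq_mul] at h
    have : s / -L v * L v = -s := by
      field_simp [hneg.ne]
    linarith
  let _ : MeasurableSpace T := borel T
  have : BorelSpace T := ⟨rfl⟩
  let P : C_c(T, ℝ) →ₚ[ℝ] ℝ :=
    { toFun := fun u => L u.toContinuousMap
      map_add' := fun u v => by
        rw [← map_add]; rfl
      map_smul' := fun c u => by
        rw [RingHom.id_apply, ← map_smul]; rfl
      monotone' := fun u v huv => by
        have := hpos (v.toContinuousMap - u.toContinuousMap) (fun x => sub_nonneg.2 (huv x))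
        rw [map_sub] at this
        exact sub_nonneg.1 this }
  let μ := RealRMK.rieszMeasure P
  have hint : ∀ v : C(T, ℝ), ∫ x, v x ∂μ = L v := fun v =>
    RealRMK.integral_rieszMeasure P (CompactlySupportedContinuousMap.continuousMapEquiv v)
  have hfin : MeasureTheory.IsFiniteMeasure μ := inferInstance
  have hz : Tendsto (fun i => L (g i)) atTop (𝓝 0) := by
    have := MeasureTheory.tendsto_integral_of_dominated_convergence (μ := μ)
      (F := fun i x => g i x) (f := fun _ => 0) (fun _ => M)
      (fun i => (g i).continuous.measurable.aestronglyMeasurable)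
      (MeasureTheory.integrable_const M)
      (fun i => Eventually.of_forall fun x => hM i x) (Eventually.of_forall hlim)
    simpa [hint] using this
  exact hs.not_ge (ge_of_tendsto' hz fun i => hLC _ (hg i))

section

variable {Y : Type*} [NormedAddCommGroup Y] [NormedSpace ℝ Y]

/-- A bounded set of functionals is totally bounded for the seminorm given by finitely many
evaluations. -/
theorem exists_finset_approx {A : Set (Y →L[ℝ] ℝ)} (hA : IsBounded A)
    (φ : (Y →L[ℝ] ℝ) →L[ℝ] ℝ) (S : Finset Y) {δ : ℝ} (hδ : 0 < δ) :
    ∃ E : Finset (Y →L[ℝ] ℝ), (∀ d ∈ E, d ∈ A) ∧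
      ∀ a ∈ A, ∃ d ∈ E, |φ d - φ a| < δ ∧ ∀ y ∈ S, |d y - a y| < δ := by
  classical
  let T : (Y →L[ℝ] ℝ) →L[ℝ] (S → ℝ) × ℝ :=
    (ContinuousLinearMap.pi fun y : S => NormedSpace.inclusionInDoubleDual ℝ Y y).prod φ
  have hTA : TotallyBounded (T '' A) :=
    (T.lipschitz.isBounded_image hA).isCompact_closure.totallyBounded.subset subset_closure
  obtain ⟨t, htA, htf, ht⟩ := hTA.exists_subset (Metric.dist_mem_uniformity hδ)
  obtain ⟨E, hEA, hEf, rfl⟩ := Set.exists_subset_image_finite_and.1 ⟨t, htA, htf, rfl⟩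
  refine ⟨hEf.toFinset, fun d hd => hEA (by simpa using hd), fun a ha => ?_⟩
  have h := ht (Set.mem_image_of_mem T ha)
  simp only [Set.mem_iUnion, Set.mem_image, Set.mem_ofPred_eq] at h
  obtain ⟨_, ⟨d, hd, rfl⟩, hdist⟩ := h
  rw [Prod.dist_eq, max_lt_iff, dist_pi_lt_iff hδ] at hdist
  refine ⟨d, by simpa using hd, ?_, fun y hy => ?_⟩
  · rw [abs_sub_comm]
    exact hdist.2
  · rw [abs_sub_comm]
    exact hdist.1 ⟨y, hy⟩

theorem continuous_eval_wstarTop (y : Y) :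
    @Continuous _ _ (wstarTop Y) _ (fun f : Y →L[ℝ] ℝ => f y) := by
  let _ := wstarTop Y
  exact (continuous_apply y).comp continuous_induced_dom

theorem exists_mem_approx {F : Set Y} {φ : (Y →L[ℝ] ℝ) →L[ℝ] ℝ}
    (hφ : φ ∈ wstarClosure (NormedSpace.inclusionInDoubleDual ℝ Y '' F))
    (E : Finset (Y →L[ℝ] ℝ)) {δ : ℝ} (hδ : 0 < δ) :
    ∃ f ∈ F, ∀ e ∈ E, |e f - φ e| < δ := by
  let _ := wstarTop (Y →L[ℝ] ℝ)
  have hU : IsOpen (⋂ e ∈ E, {ψ : (Y →L[ℝ] ℝ) →L[ℝ] ℝ | |ψ e - φ e| < δ}) :=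
    isOpen_biInter_finset fun e _ =>
      isOpen_lt ((continuous_eval_wstarTop e).sub continuous_const).abs continuous_const
  obtain ⟨_, hψ, f, hf, rfl⟩ := mem_closure_iff.1 hφ _ hU (by simp [hδ])
  refine ⟨f, hf, fun e he => ?_⟩
  simpa using Set.mem_iInter₂.1 hψ e he

theorem isCompact_wstarClosure {B : Set (Y →L[ℝ] ℝ)} (hB : IsBounded B) :
    @IsCompact _ (wstarTop Y) (wstarClosure B) := by
  obtain ⟨r, hr⟩ := hB.subset_closedBall 0
  have hc : @IsCompact _ (wstarTop Y) (Metric.closedBall (0 : Y →L[ℝ] ℝ) r) :=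
    WeakDual.isCompact_closedBall (0 : StrongDual ℝ Y) r
  have hcl : @IsClosed _ (wstarTop Y) (Metric.closedBall (0 : Y →L[ℝ] ℝ) r) :=
    WeakDual.isClosed_closedBall (0 : StrongDual ℝ Y) r
  let _ := wstarTop Y
  exact hc.of_isClosed_subset isClosed_closure (closure_minimal hr hcl)

/-- Simultaneous choice of a sequence in `F` approximating `φ` on finite sets of functionals, and
of finite subsets of `A` approximating all of `A` on the terms of the sequence. -/
theorem exists_seq_finset_approx {F : Set Y} {A : Set (Y →L[ℝ] ℝ)} (hA : IsBounded A)
    {φ : (Y →L[ℝ] ℝ) →L[ℝ] ℝ}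
    (hφ : φ ∈ wstarClosure (NormedSpace.inclusionInDoubleDual ℝ Y '' F)) (b : Y →L[ℝ] ℝ) :
    ∃ (f : ℕ → Y) (D : ℕ → Finset (Y →L[ℝ] ℝ)), (∀ n, f n ∈ F) ∧ (∀ n, ∀ d ∈ D n, d ∈ A) ∧
      (∀ n, ∀ a ∈ A, ∃ d ∈ D n, |φ d - φ a| < 1 / ((n : ℝ) + 1) ∧
        ∀ i < n, |d (f i) - a (f i)| < 1 / ((n : ℝ) + 1)) ∧
      (∀ m, ∀ d ∈ D m, Tendsto (fun n => d (f n)) atTop (𝓝 (φ d))) ∧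
      Tendsto (fun n => b (f n)) atTop (𝓝 (φ b)) := by
  classical
  let P : Y × Finset Y × Finset (Y →L[ℝ] ℝ) × ℕ → Prop := fun x =>
    x.1 ∈ F ∧ (∀ d ∈ x.2.2.1, d ∈ A) ∧ |b x.1 - φ b| < 1 / ((x.2.2.2 : ℝ) + 1) ∧
      ∀ a ∈ A, ∃ d ∈ x.2.2.1, |φ d - φ a| < 1 / ((x.2.2.2 : ℝ) + 1) ∧
        ∀ y ∈ x.2.1, |d y - a y| < 1 / ((x.2.2.2 : ℝ) + 1)
  let R : Y × Finset Y × Finset (Y →L[ℝ] ℝ) × ℕ → Y × Finset Y × Finset (Y →L[ℝ] ℝ) × ℕ → Prop :=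
    fun x y => x.1 ∈ y.2.1 ∧ x.2.2.2 < y.2.2.2 ∧
      ∀ d ∈ x.2.2.1, |d y.1 - φ d| < 1 / ((y.2.2.2 : ℝ) + 1)
  obtain ⟨q, hqP, hqR⟩ := exists_seq_of_forall_finset_exists P R (fun s _ => by
    let k := s.sup (fun x => x.2.2.2) + 1
    have hk : (0 : ℝ) < 1 / ((k : ℝ) + 1) := Nat.one_div_pos_of_nat
    obtain ⟨E, hEA, hE⟩ := exists_finset_approx hA φ (s.image Prod.fst) hk
    obtain ⟨f, hf, hfE⟩ := exists_mem_approx hφ (insert b (s.biUnion fun x => x.2.2.1)) hk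
    refine ⟨(f, s.image Prod.fst, E, k), ⟨hf, hEA, hfE b (by simp), hE⟩, fun x hx =>
      ⟨Finset.mem_image_of_mem _ hx, Nat.lt_succ_of_le (Finset.le_sup (f := fun x => x.2.2.2) hx),
        fun d hd => hfE d ?_⟩⟩
    exact Finset.mem_insert_of_mem (Finset.mem_biUnion.2 ⟨x, hx, hd⟩))
  have hmono : StrictMono fun n => (q n).2.2.2 := fun m n hmn => (hqR m n hmn).2.1
  have hle : ∀ n : ℕ, 1 / (((q n).2.2.2 : ℝ) + 1) ≤ 1 / ((n : ℝ) + 1) := fun n =>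
    Nat.one_div_le_one_div (hmono.id_le n)
  refine ⟨fun n => (q n).1, fun n => (q n).2.2.1, fun n => (hqP n).1, fun n => (hqP n).2.1,
    fun n a ha => ?_, fun m d hd => ?_, ?_⟩
  · obtain ⟨d, hd, h₁, h₂⟩ := (hqP n).2.2.2 a ha
    exact ⟨d, hd, h₁.trans_le (hle n), fun i hi => (h₂ _ (hqR i n hi).1).trans_le (hle n)⟩
  · rw [tendsto_iff_dist_tendsto_zero]
    refine squeeze_zero' (Eventually.of_forall fun _ => dist_nonneg) ?_
      tendsto_one_div_add_atTop_nhds_zero_nat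
    filter_upwards [eventually_gt_atTop m] with n hn
    exact ((hqR m n hn).2.2 d hd).le.trans (hle n)
  · rw [tendsto_iff_dist_tendsto_zero]
    exact squeeze_zero (fun _ => dist_nonneg) (fun n => (hqP n).2.2.1.le.trans (hle n))
      tendsto_one_div_add_atTop_nhds_zero_nat

theorem MapClusterPt.eq_of_tendsto {Z : Type*} [TopologicalSpace Z] [T2Space Z] {u : ℕ → Z}
    {x y : Z} (hx : MapClusterPt x atTop u) (hy : Tendsto u atTop (𝓝 y)) : x = y := by
  have : (𝓝 x ⊓ 𝓝 y).NeBot := NeBot.mono hx (inf_le_inf_left _ hy)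
  exact eq_of_nhds_neBot this

/-- Relative countable compactness of `A` in `C(K)` with the topology of pointwise convergence,
where `K` is a set of functionals on the dual. -/
def RelCountablyCompactOn (A : Set (Y →L[ℝ] ℝ)) (K : Set ((Y →L[ℝ] ℝ) →L[ℝ] ℝ)) : Prop :=
  ∀ a : ℕ → (Y →L[ℝ] ℝ), (∀ m, a m ∈ A) →
    ∃ g : K → ℝ, @Continuous _ _ (subTop (wstarTop (Y →L[ℝ] ℝ)) K) _ g ∧
      MapClusterPt g atTop (fun m => fun φ : K => (φ : (Y →L[ℝ] ℝ) →L[ℝ] ℝ) (a m))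

/-- Interchange of limits: the sequences produced by `exists_seq_finset_approx` converge at all
pointwise limits of sequences in `A`. -/
theorem tendsto_of_forall_tendsto_eval {A : Set (Y →L[ℝ] ℝ)}
    {K : Set ((Y →L[ℝ] ℝ) →L[ℝ] ℝ)} (hK : @IsCompact _ (wstarTop (Y →L[ℝ] ℝ)) K)
    (hcc : RelCountablyCompactOn A K) {φ : (Y →L[ℝ] ℝ) →L[ℝ] ℝ}
    {f : ℕ → Y} (hfK : ∀ n, NormedSpace.inclusionInDoubleDual ℝ Y (f n) ∈ K)
    {D : ℕ → Finset (Y →L[ℝ] ℝ)} (hDA : ∀ n, ∀ d ∈ D n, d ∈ A)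
    (hD : ∀ n, ∀ a ∈ A, ∃ d ∈ D n, |φ d - φ a| < 1 / ((n : ℝ) + 1) ∧
        ∀ i < n, |d (f i) - a (f i)| < 1 / ((n : ℝ) + 1))
    (hfD : ∀ m, ∀ d ∈ D m, Tendsto (fun n => d (f n)) atTop (𝓝 (φ d)))
    {a : ℕ → Y →L[ℝ] ℝ} (ha : ∀ n, a n ∈ A) {x : ℕ → ℝ} {c : ℝ}
    (hx : ∀ i, Tendsto (fun n => a n (f i)) atTop (𝓝 (x i)))
    (hc : Tendsto (fun n => φ (a n)) atTop (𝓝 c)) : Tendsto x atTop (𝓝 c) := by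
  choose d hdD hdφ hdf using fun n => hD n (a n) (ha n)
  have hφd : Tendsto (fun n => φ (d n)) atTop (𝓝 c) := by
    have h : Tendsto (fun n => φ (d n) - φ (a n)) atTop (𝓝 0) :=
      squeeze_zero_norm (fun n => (hdφ n).le) tendsto_one_div_add_atTop_nhds_zero_nat
    simpa using h.add hc
  have hfd : ∀ i, Tendsto (fun n => d n (f i)) atTop (𝓝 (x i)) := by
    intro i
    have h : Tendsto (fun n => d n (f i) - a n (f i)) atTop (𝓝 0) := by
      refine squeeze_zero_norm' ?_ tendsto_one_div_add_atTop_nhds_zero_nat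
      filter_upwards [eventually_gt_atTop i] with n hn
      exact (hdf n i hn).le
    simpa using h.add (hx i)
  obtain ⟨g, hg, hgd⟩ := hcc d fun n => hDA n _ (hdD n)
  have hgψ : ∀ ψ : K, MapClusterPt (g ψ) atTop
      (fun n => (ψ : (Y →L[ℝ] ℝ) →L[ℝ] ℝ) (d n)) := fun ψ =>
    hgd.continuousAt_comp (continuous_apply ψ).continuousAt
  have hgf : ∀ i, g ⟨_, hfK i⟩ = x i := fun i => (hgψ ⟨_, hfK i⟩).eq_of_tendsto (hfd i)
  rw [tendsto_iff_ultrafilter]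
  intro p hp
  let _ := wstarTop (Y →L[ℝ] ℝ)
  let _ : TopologicalSpace K := subTop (wstarTop (Y →L[ℝ] ℝ)) K
  have : CompactSpace K := isCompact_iff_compactSpace.1 hK
  let u : ℕ → K := fun i => ⟨_, hfK i⟩
  obtain ⟨ψ, -, hψ⟩ := isCompact_univ.ultrafilter_le_nhds (p.map u) (by simp)
  have hψu : Tendsto u p (𝓝 ψ) := hψ
  have hψD : ∀ n, (ψ : (Y →L[ℝ] ℝ) →L[ℝ] ℝ) (d n) = φ (d n) := fun n =>
    tendsto_nhds_unique
      ((((continuous_eval_wstarTop (d n)).comp continuous_induced_dom).tendsto ψ).comp hψu)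
      ((hfD n (d n) (hdD n)).mono_left hp)
  have hgc : g ψ = c := (hgψ ψ).eq_of_tendsto (by simpa only [hψD] using hφd)
  have := (hg.tendsto ψ).comp hψu
  rw [hgc] at this
  exact this.congr hgf

theorem exists_approx_on {F : Set Y} (hF : IsBounded F) {A : Set (Y →L[ℝ] ℝ)} (hA : IsBounded A)
    (hcc : RelCountablyCompactOn A (wstarClosure (NormedSpace.inclusionInDoubleDual ℝ Y '' F)))
    {φ : (Y →L[ℝ] ℝ) →L[ℝ] ℝ}
    (hφ : φ ∈ wstarClosure (NormedSpace.inclusionInDoubleDual ℝ Y '' F)) (b : Y →L[ℝ] ℝ)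
    {ε : ℝ} (hε : 0 < ε) :
    ∃ y : Y, |b y - φ b| < ε ∧ ∀ a ∈ A, |a y - φ a| < ε := by
  obtain ⟨f, D, hfF, hDA, hD, hfD, hfb⟩ := exists_seq_finset_approx hA hφ b
  have hK := isCompact_wstarClosure
    ((NormedSpace.inclusionInDoubleDual ℝ Y).lipschitz.isBounded_image hF)
  have hfK : ∀ n, NormedSpace.inclusionInDoubleDual ℝ Y (f n) ∈
      wstarClosure (NormedSpace.inclusionInDoubleDual ℝ Y '' F) := fun n =>
    @subset_closure _ (wstarTop _) _ _ (Set.mem_image_of_mem _ (hfF n))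
  obtain ⟨r, hr⟩ := hF.exists_norm_le
  obtain ⟨s, hs⟩ := hA.exists_norm_le
  let e : (Y →L[ℝ] ℝ) → (ℕ → ℝ) × ℝ := fun a => (fun i => a (f i), φ a)
  let J : Set ((ℕ → ℝ) × ℝ) := closure (e '' A)
  have hJsub : J ⊆ (Set.univ.pi fun _ => Metric.closedBall 0 (s * r)) ×ˢ
      Metric.closedBall 0 (‖φ‖ * s) := by
    refine closure_minimal ?_
      ((isClosed_set_pi fun _ _ => Metric.isClosed_closedBall).prod Metric.isClosed_closedBall)
    rintro _ ⟨a, ha, rfl⟩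
    refine ⟨fun i _ => ?_, ?_⟩
    · exact mem_closedBall_zero_iff.2 (a.le_of_opNorm_le_of_le (hs a ha) (hr _ (hfF i)))
    · exact mem_closedBall_zero_iff.2 (φ.le_opNorm_of_le (hs a ha))
  have hJc : IsCompact J :=
    ((isCompact_univ_pi fun _ => isCompact_closedBall _ _).prod
      (isCompact_closedBall _ _)).of_isClosed_subset isClosed_closure hJsub
  have : CompactSpace J := isCompact_iff_compactSpace.1 hJc
  have hlim : ∀ z ∈ J, Tendsto z.1 atTop (𝓝 z.2) := by
    intro z hz
    obtain ⟨w, hw, hwz⟩ := mem_closure_iff_seq_limit.1 hz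
    choose a ha haw using hw
    rw [nhds_prod_eq, tendsto_prod_iff', tendsto_pi_nhds] at hwz
    simp only [← haw, e] at hwz
    exact tendsto_of_forall_tendsto_eval hK hcc hfK hDA hD hfD ha hwz.1 hwz.2
  obtain ⟨N, hN⟩ := (Metric.tendsto_atTop.1 hfb) ε hε
  let ev : A → J := fun a => ⟨e a, subset_closure (Set.mem_image_of_mem e a.2)⟩
  let C : Set C(J, ℝ) :=
    {G | ∃ y : Y, |b y - φ b| < ε ∧ ∀ a : A, |(a : Y →L[ℝ] ℝ) y - φ a| ≤ G (ev a)}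
  have hC : Convex ℝ C := by
    rintro G ⟨y, hyb, hy⟩ H ⟨z, hzb, hz⟩ α β hα hβ hαβ
    have key : ∀ a : Y →L[ℝ] ℝ,
        a (α • y + β • z) - φ a = α * (a y - φ a) + β * (a z - φ a) := by
      intro a
      simp only [map_add, map_smul, smul_eq_mul]
      linear_combination φ a * hαβ
    refine ⟨α • y + β • z, ?_, fun a => ?_⟩
    · rw [key]
      have := convex_ball (0 : ℝ) ε (x := b y - φ b) (by simpa using hyb)
        (y := b z - φ b) (by simpa using hzb) hα hβ hαβ
      simpa using this
    · rw [key]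
      refine (abs_add_le _ _).trans ?_
      rw [abs_mul, abs_mul, abs_of_nonneg hα, abs_of_nonneg hβ]
      exact add_le_add (mul_le_mul_of_nonneg_left (hy a) hα) (mul_le_mul_of_nonneg_left (hz a) hβ)
  let g : ℕ → C(J, ℝ) := fun i =>
    ⟨fun z => |z.1.1 (i + N) - z.1.2|, by fun_prop⟩
  have hgC : ∀ i, g i ∈ C := fun i =>
    ⟨f (i + N), hN _ (Nat.le_add_left _ _), fun a => le_rfl⟩
  have hgM : ∀ i z, |g i z| ≤ s * r + ‖φ‖ * s := by
    intro i z
    have hz := hJsub z.2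
    have h₁ : |z.1.1 (i + N)| ≤ s * r := mem_closedBall_zero_iff.1 (hz.1 (i + N) trivial)
    have h₂ : |z.1.2| ≤ ‖φ‖ * s := mem_closedBall_zero_iff.1 hz.2
    have h₃ : |g i z| = |z.1.1 (i + N) - z.1.2| := abs_abs _
    rw [h₃]
    exact (abs_sub _ _).trans (add_le_add h₁ h₂)
  have hg0 : ∀ z, Tendsto (fun i => g i z) atTop (𝓝 0) := by
    intro z
    have h := (((tendsto_add_atTop_iff_nat N).2 (hlim z z.2)).sub_const z.1.2).abs
    rw [sub_self, abs_zero] at h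
    exact h
  obtain ⟨G, ⟨y, hyb, hy⟩, hG⟩ := exists_mem_lt_of_tendsto_zero hC hgC hgM hg0 hε
  exact ⟨y, hyb, fun a ha => (hy ⟨a, ha⟩).trans_lt (hG _)⟩

/-- If `A` is norming, functionals on the dual that can be approximated by points of `Y` uniformly
on `A ∪ {b}`, for every `b`, are evaluations at points of `Y`. -/
theorem mem_range_inclusionInDoubleDual [CompleteSpace Y] {A : Set (Y →L[ℝ] ℝ)}
    (hnorming : ∀ y : Y, ‖y‖ = sSup ((fun a : Y →L[ℝ] ℝ => |a y|) '' A))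
    {φ : (Y →L[ℝ] ℝ) →L[ℝ] ℝ}
    (h : ∀ b : Y →L[ℝ] ℝ, ∀ ε > 0, ∃ y : Y, |b y - φ b| < ε ∧ ∀ a ∈ A, |a y - φ a| < ε) :
    φ ∈ Set.range (NormedSpace.inclusionInDoubleDual ℝ Y) := by
  have hnorm : ∀ (y : Y) (t : ℝ), 0 ≤ t → (∀ a ∈ A, |a y| ≤ t) → ‖y‖ ≤ t := by
    intro y t ht hy
    rw [hnorming]
    refine Real.sSup_le ?_ ht
    rintro _ ⟨a, ha, rfl⟩
    exact hy a ha
  have hex : ∀ b : Y →L[ℝ] ℝ, ∃ y : Y, b y = φ b ∧ ∀ a ∈ A, a y = φ a := by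
    intro b
    have hpos : ∀ n : ℕ, (0 : ℝ) < 1 / ((n : ℝ) + 1) := fun n => Nat.one_div_pos_of_nat
    choose y hyb hy using fun n : ℕ => h b _ (hpos n)
    have hcau : CauchySeq y := by
      refine cauchySeq_of_le_tendsto_0 (fun n : ℕ => 1 / ((n : ℝ) + 1) + 1 / ((n : ℝ) + 1)) ?_ ?_
      · intro n m N hn hm
        rw [dist_eq_norm]
        refine hnorm _ _ (add_pos (hpos N) (hpos N)).le fun a ha => ?_
        have h₁ := (hy n a ha).le.trans (Nat.one_div_le_one_div (α := ℝ) hn)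
        have h₂ := (hy m a ha).le.trans (Nat.one_div_le_one_div (α := ℝ) hm)
        rw [abs_sub_comm] at h₂
        rw [map_sub]
        exact (abs_sub_le _ (φ a) _).trans (add_le_add h₁ h₂)
      · simpa using (tendsto_one_div_add_atTop_nhds_zero_nat (𝕜 := ℝ)).add
          (tendsto_one_div_add_atTop_nhds_zero_nat (𝕜 := ℝ))
    obtain ⟨z, hz⟩ := cauchySeq_tendsto_of_complete hcau
    have hlim : ∀ a : Y →L[ℝ] ℝ, (∀ n : ℕ, |a (y n) - φ a| < 1 / ((n : ℝ) + 1)) → a z = φ a := by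
      intro a ha
      refine tendsto_nhds_unique ((a.continuous.tendsto z).comp hz) ?_
      rw [tendsto_iff_dist_tendsto_zero]
      exact squeeze_zero (fun _ => dist_nonneg) (fun n => (ha n).le)
        tendsto_one_div_add_atTop_nhds_zero_nat
    exact ⟨z, hlim b hyb, fun a ha => hlim a fun n => hy n a ha⟩
  obtain ⟨y, -, hy⟩ := hex 0
  refine ⟨y, ContinuousLinearMap.ext fun b => ?_⟩
  obtain ⟨z, hzb, hz⟩ := hex b
  have : y - z = 0 := norm_le_zero_iff.1 <| hnorm _ _ le_rfl fun a ha => by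
    rw [map_sub, hy a ha, hz a ha, sub_self, abs_zero]
  rw [NormedSpace.dual_def, sub_eq_zero.1 this, hzb]

theorem isInducing_inclusionInDoubleDual :
    @IsInducing _ _ (weakTop Y) (wstarTop (Y →L[ℝ] ℝ))
      (NormedSpace.inclusionInDoubleDual ℝ Y) :=
  @IsInducing.mk _ _ (weakTop Y) (wstarTop (Y →L[ℝ] ℝ)) _ <| by
    unfold weakTop wstarTop
    rw [induced_compose]
    rfl

theorem isCompact_closure_of_isInducing {S T : Type*} [TopologicalSpace S] [TopologicalSpace T]
    {f : S → T} (hf : IsInducing f) {s : Set S} (hs : IsCompact (closure (f '' s)))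
    (hr : closure (f '' s) ⊆ Set.range f) : IsCompact (closure s) := by
  rwa [hf.isCompact_iff, hf.closure_eq_preimage_closure_image, Set.image_preimage_eq_of_subset hr]

theorem isCompact_closure_weakTop {F : Set Y} (hF : IsBounded F)
    (hr : wstarClosure (NormedSpace.inclusionInDoubleDual ℝ Y '' F) ⊆
      Set.range (NormedSpace.inclusionInDoubleDual ℝ Y)) :
    @IsCompact Y (weakTop Y) (@closure Y (weakTop Y) F) := by
  have hK := isCompact_wstarClosure
    ((NormedSpace.inclusionInDoubleDual ℝ Y).lipschitz.isBounded_image hF)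
  exact @isCompact_closure_of_isInducing _ _ (weakTop Y) (wstarTop (Y →L[ℝ] ℝ)) _
    isInducing_inclusionInDoubleDual F hK hr

end

/-- if `A ⊆ Y*` is norming for `Y` and `A|_{cl_w*(F)}` is relatively
countably compact in `(C(cl_w*(F)), τ_p)`, then `F` is relatively weakly compact. -/
theorem stmt3 {Y : Type*} [NormedAddCommGroup Y] [NormedSpace ℝ Y] [CompleteSpace Y]
    (F : Set Y) (A : Set (Y →L[ℝ] ℝ))
    (hF : IsBounded F) (hA : IsBounded A)
    (hAball : A ⊆ Metric.closedBall 0 1)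
    -- `A` is norming for `Y`:
    (hnorming : ∀ y : Y, ‖y‖ = sSup ((fun a : Y →L[ℝ] ℝ => |a y|) '' A))
    (K : Set ((Y →L[ℝ] ℝ) →L[ℝ] ℝ))
    (hK : K = @closure _ (wstarTop (Y →L[ℝ] ℝ)) ((NormedSpace.inclusionInDoubleDual ℝ Y) '' F))
    -- relative countable compactness of `A|_K` in `(C(K), τ_p)`:
    (hcc : ∀ a : ℕ → (Y →L[ℝ] ℝ), (∀ m, a m ∈ A) →
      ∃ g : K → ℝ, @Continuous _ _ (subTop (wstarTop (Y →L[ℝ] ℝ)) K) _ g ∧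
        MapClusterPt g atTop (fun m => fun φ : K => (φ : (Y →L[ℝ] ℝ) →L[ℝ] ℝ) (a m))) :
    -- `F` is relatively weakly compact:
    @IsCompact Y (weakTop Y) (@closure Y (weakTop Y) F) := by
  subst hK
  have hcc' : RelCountablyCompactOn A
      (wstarClosure (NormedSpace.inclusionInDoubleDual ℝ Y '' F)) := hcc
  have hKr : wstarClosure (NormedSpace.inclusionInDoubleDual ℝ Y '' F) ⊆
      Set.range (NormedSpace.inclusionInDoubleDual ℝ Y) := fun φ hφ =>
    mem_range_inclusionInDoubleDual hnorming fun b ε hε => exists_approx_on hF hA hcc' hφ b hε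
  exact isCompact_closure_weakTop hF hKr
end
end

section
/- Let X be a real Banach space, A ⊆ X a bounded set, and F ⊆ X* a bounded set such that for each x ∈ aco_∞(A) there exists f ∈ F with f(x) = sup_{g ∈ cl_{w*}(co F)} g(x). If A is countably compact in the topology τ_F of pointwise convergence on F, then A is sequentially compact in the topology τ_{cl_{w*}(co F)} of pointwise convergence on cl_{w*}(co F). -/
open Filter Topology Metric Bornology

noncomputable section

variable {X : Type*} [NormedAddCommGroup X] [NormedSpace ℝ X]

section AcoInf

theorem hasSum_mem_acoInf [CompleteSpace X] {A : Set X} (hA : IsBounded A) {c : ℕ → ℝ}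
    {x : ℕ → X} {s : X} (hx : ∀ n, x n ∈ acoInf A) (hc : HasSum (fun n => |c n|) 1)
    (hs : HasSum (fun n => c n • x n) s) : s ∈ acoInf A := by
  choose a u hu hsum hone hhas using hx
  obtain ⟨R, hR⟩ := hA.exists_norm_le
  have hfib : ∀ n, HasSum (fun k => |c n * a n k|) |c n| := fun n => by
    have := ((hsum n).hasSum.mul_left |c n|)
    rw [hone n, mul_one] at this
    simpa [abs_mul] using this
  have habs : Summable (fun p : ℕ × ℕ => |c p.1 * a p.1 p.2|) := by
    rw [summable_prod_of_nonneg (fun _ => abs_nonneg _)]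
    refine ⟨fun n => (hfib n).summable, ?_⟩
    exact hc.summable.congr fun n => (hfib n).tsum_eq.symm
  have hone' : HasSum (fun p : ℕ × ℕ => |c p.1 * a p.1 p.2|) 1 := by
    have h1 := habs.hasSum
    rwa [(h1.prod_fiberwise hfib).unique hc] at h1
  have hv : Summable (fun p : ℕ × ℕ => (c p.1 * a p.1 p.2) • u p.1 p.2) := by
    refine Summable.of_norm_bounded (habs.mul_right R) fun p => ?_
    rw [norm_smul, Real.norm_eq_abs]
    exact mul_le_mul_of_nonneg_left (hR _ (hu _ _)) (abs_nonneg _)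
  have hv' : HasSum (fun p : ℕ × ℕ => (c p.1 * a p.1 p.2) • u p.1 p.2) s := by
    have h1 := hv.hasSum
    have h2 := h1.prod_fiberwise (fun n => by
      simpa [mul_smul] using (hhas n).const_smul (c n))
    rwa [h2.unique hs] at h1
  obtain ⟨e⟩ : Nonempty (ℕ ≃ ℕ × ℕ) := ⟨Nat.pairEquiv.symm⟩
  have h1 : HasSum (fun n => |c (e n).1 * a (e n).1 (e n).2|) 1 := (e.hasSum_iff).2 hone'
  exact ⟨fun n => c (e n).1 * a (e n).1 (e n).2, fun n => u (e n).1 (e n).2,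
    fun n => hu _ _, h1.summable, h1.tsum_eq, (e.hasSum_iff).2 hv'⟩

theorem subset_acoInf (A : Set X) : A ⊆ acoInf A := fun x hx => by
  have h : HasSum (fun n : ℕ => |if n = 0 then (1 : ℝ) else 0|) 1 := by
    simpa using hasSum_single (f := fun n : ℕ => |if n = 0 then (1 : ℝ) else 0|) 0
      (fun n hn => by simp [hn])
  refine ⟨fun n => if n = 0 then 1 else 0, fun _ => x, fun _ => hx, h.summable, h.tsum_eq, ?_⟩
  simpa using hasSum_single (f := fun n : ℕ => (if n = 0 then (1 : ℝ) else 0) • x) 0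
    (fun n hn => by simp [hn])

theorem smul_add_smul_mem_acoInf [CompleteSpace X] {A : Set X} (hA : IsBounded A) {a b : ℝ}
    (hab : |a| + |b| = 1) {x y : X} (hx : x ∈ acoInf A) (hy : y ∈ acoInf A) :
    a • x + b • y ∈ acoInf A := by
  refine hasSum_mem_acoInf hA (c := fun n => if n = 0 then a else if n = 1 then b else 0)
    (x := fun n => if n = 0 then x else y) (fun n => by split_ifs <;> assumption) ?_ ?_
  · rw [← hab]
    have := hasSum_sum_of_ne_finset_zero (L := .unconditional ℕ) (s := Finset.range 2)
      (f := fun n : ℕ => |if n = 0 then a else if n = 1 then b else 0|) (fun n hn => by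
        have : n ≠ 0 ∧ n ≠ 1 := by simp at hn; omega
        simp [this])
    simpa [Finset.sum_range_succ] using this
  · have := hasSum_sum_of_ne_finset_zero (L := .unconditional ℕ) (s := Finset.range 2)
      (f := fun n : ℕ => (if n = 0 then a else if n = 1 then b else 0) •
        (if n = 0 then x else y)) (fun n hn => by
        have : n ≠ 0 ∧ n ≠ 1 := by simp at hn; omega
        simp [this])
    simpa [Finset.sum_range_succ] using this

theorem convex_acoInf [CompleteSpace X] {A : Set X} (hA : IsBounded A) :
    Convex ℝ (acoInf A) := fun x hx y hy a b ha hb hab =>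
  smul_add_smul_mem_acoInf hA (by rwa [abs_of_nonneg ha, abs_of_nonneg hb]) hx hy

theorem norm_le_of_mem_acoInf {A : Set X} {C : ℝ} (hC : ∀ x ∈ A, ‖x‖ ≤ C) {x : X}
    (hx : x ∈ acoInf A) : ‖x‖ ≤ C := by
  obtain ⟨a, u, hu, hsum, hone, hhas⟩ := hx
  have hb : ∀ n, ‖a n • u n‖ ≤ |a n| * C := fun n => by
    rw [norm_smul, Real.norm_eq_abs]
    exact mul_le_mul_of_nonneg_left (hC _ (hu n)) (abs_nonneg _)
  have h := tsum_of_norm_bounded (hsum.hasSum.mul_right C) hb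
  rwa [hhas.tsum_eq, hone, one_mul] at h

end AcoInf

section Diagonal

variable {T : Type*}

/-- Every infinite subset of `M` is visited infinitely often, with either sign, by some `t ∈ Φ`. -/
def Rich (B : Bool → ℕ → Set T) (Φ : Set T) (M : Set ℕ) : Prop :=
  ∀ Y ⊆ M, Y.Infinite → ∃ t ∈ Φ, ∀ b, {n ∈ Y | t ∈ B b n}.Infinite

theorem Rich.mono {B : Bool → ℕ → Set T} {Φ : Set T} {M M' : Set ℕ} (h : Rich B Φ M)
    (hM : M' ⊆ M) : Rich B Φ M' := fun Y hY => h Y (hY.trans hM)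

theorem infinite_inter_of_tail {S Y : Set ℕ} (hY : Y.Infinite) {N : ℕ}
    (h : ∀ n ∈ Y, N ≤ n → n ∈ S) : (Y ∩ S).Infinite := by
  refine (hY.sdiff (Set.finite_Iio N)).mono fun n hn => ⟨hn.1, h n hn.1 ?_⟩
  simpa using hn.2

theorem Rich.of_tail {B : Bool → ℕ → Set T} {Φ : Set T} {M M' : Set ℕ} (h : Rich B Φ M) {N : ℕ}
    (hM : ∀ n ∈ M', N ≤ n → n ∈ M) : Rich B Φ M' := fun Y hY hinf => by
  obtain ⟨t, ht, hb⟩ := h (Y ∩ M) Set.inter_subset_right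
    (infinite_inter_of_tail hinf fun n hn => hM n (hY hn))
  exact ⟨t, ht, fun b => (hb b).mono fun n hn => ⟨hn.1.1, hn.2⟩⟩

theorem exists_strictMono_mem {S : ℕ → Set ℕ} (hS : ∀ i, (S i).Infinite) :
    ∃ k : ℕ → ℕ, StrictMono k ∧ ∀ i, k i ∈ S i := by
  choose g hg hlt using fun (i n : ℕ) => (hS i).exists_gt n
  let k : ℕ → ℕ := fun i => Nat.rec (g 0 0) (fun i p => g (i + 1) p) i
  refine ⟨k, strictMono_nat_of_lt_succ fun i => hlt _ _, fun i => ?_⟩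
  cases i <;> exact hg _ _

theorem Rich.exists_extend {B : Bool → ℕ → Set T} {Φ : Set T} {M : Set ℕ} (h : Rich B Φ M)
    (hM : M.Infinite) (b : Bool) :
    ∃ M' ⊆ M, M'.Infinite ∧ ∀ n ∈ M', Rich B (Φ ∩ B b n) M' := by
  by_contra! hcon
  have key : ∀ S : {S : Set ℕ // S ⊆ M ∧ S.Infinite}, ∃ n ∈ S.1, ∃ Y ⊆ S.1, Y.Infinite ∧
      ¬ ∃ t ∈ Φ ∩ B b n, ∀ b', {n ∈ Y | t ∈ B b' n}.Infinite := fun S => by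
    obtain ⟨n, hn, hr⟩ := hcon S.1 S.2.1 S.2.2
    simp only [Rich, not_forall] at hr
    obtain ⟨Y, hY, hinf, hno⟩ := hr
    exact ⟨n, hn, Y, hY, hinf, hno⟩
  choose n hn Y hYS hY hno using key
  let nxt : {S : Set ℕ // S ⊆ M ∧ S.Infinite} → {S : Set ℕ // S ⊆ M ∧ S.Infinite} := fun S =>
    ⟨Y S \ Set.Iic (n S), (Set.sdiff_subset.trans (hYS S)).trans S.2.1,
      (hY S).sdiff (Set.finite_Iic _)⟩
  let S : ℕ → {S : Set ℕ // S ⊆ M ∧ S.Infinite} := fun i => nxt^[i] ⟨M, subset_rfl, hM⟩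
  have hS : ∀ i, S (i + 1) = nxt (S i) := fun i => Function.iterate_succ_apply' nxt i _
  have hanti : Antitone fun i => (S i).1 := antitone_nat_of_succ_le fun i => by
    rw [hS]
    exact Set.sdiff_subset.trans (hYS _)
  have hlater : ∀ i j, i < j → n (S j) ∈ Y (S i) ∧ n (S i) < n (S j) := fun i j hij => by
    have h1 : n (S j) ∈ (S (i + 1)).1 := hanti hij (hn _)
    rw [hS] at h1
    exact ⟨h1.1, by simpa using h1.2⟩
  have hmono : StrictMono fun i => n (S i) := fun i j hij => (hlater i j hij).2
  obtain ⟨t, ht, hb⟩ := h (Set.range fun i => n (S i))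
    (by rintro _ ⟨i, rfl⟩; exact (S i).2.1 (hn _)) (Set.infinite_range_of_injective hmono.injective)
  obtain ⟨_, ⟨i, rfl⟩, hi⟩ := (hb b).nonempty
  refine hno (S i) ⟨t, ⟨ht, hi⟩, fun b' => ?_⟩
  refine ((hb b').sdiff (Set.finite_Iic (n (S i)))).mono ?_
  rintro _ ⟨⟨⟨j, rfl⟩, hj⟩, hgt⟩
  exact ⟨(hlater i j (hmono.lt_iff_lt.1 (by simpa using hgt))).1, hj⟩

variable (B : Bool → ℕ → ℕ → Set T)

theorem exists_extend_list (L : List (ℕ × Set T)) {M : Set ℕ} (hM : M.Infinite)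
    (hL : ∀ σ ∈ L, Rich (B · σ.1) σ.2 M) :
    ∃ M' ⊆ M, M'.Infinite ∧
      ∀ σ ∈ L, ∀ b, ∀ n ∈ M', Rich (B · σ.1) (σ.2 ∩ B b σ.1 n) M' := by
  induction L with
  | nil => exact ⟨M, subset_rfl, hM, by simp⟩
  | cons σ L ih =>
    obtain ⟨M₁, h₁, hi₁, hr₁⟩ := ih fun τ hτ => hL τ (List.mem_cons_of_mem _ hτ)
    have hσ := hL σ List.mem_cons_self
    obtain ⟨M₂, h₂, hi₂, hr₂⟩ := (hσ.mono h₁).exists_extend hi₁ true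
    obtain ⟨M₃, h₃, hi₃, hr₃⟩ := (hσ.mono (h₂.trans h₁)).exists_extend hi₂ false
    refine ⟨M₃, h₃.trans (h₂.trans h₁), hi₃, fun τ hτ b n hn => ?_⟩
    rcases List.mem_cons.1 hτ with rfl | hτ
    · cases b
      · exact hr₃ n hn
      · exact (hr₂ n (h₃ hn)).mono h₃
    · exact (hr₁ τ hτ b n (h₂ (h₃ hn))).mono (h₃.trans h₂)

/-- The members of `Φ` that follow the sign pattern `c` at `n 0, …, n (i - 1)`. -/
def pattern (Φ : Set T) (B : Bool → ℕ → Set T) (c : ℕ → Bool) (n : ℕ → ℕ) : ℕ → Set T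
  | 0 => Φ
  | i + 1 => pattern Φ B c n i ∩ B (c i) (n i)

theorem mem_pattern {Φ : Set T} {B : Bool → ℕ → Set T} {c : ℕ → Bool} {n : ℕ → ℕ} {i : ℕ} {t : T} :
    t ∈ pattern Φ B c n i ↔ t ∈ Φ ∧ ∀ j < i, t ∈ B (c j) (n j) := by
  induction i with
  | zero => simp [pattern]
  | succ i ih => rw [pattern, Set.mem_inter_iff, ih, and_assoc, Nat.forall_lt_succ_right]

theorem exists_rich_pattern (Φ : ℕ → Set T) {M : Set ℕ} (hM : M.Infinite)
    (h : ∀ m, Rich (B · m) (Φ m) M) :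
    ∃ n : ℕ → ℕ, StrictMono n ∧ (∀ i, n i ∈ M) ∧ ∀ m c i,
      Rich (B · m) (pattern (Φ m) (B · m) c (fun j => n (m + j)) i) (Set.range n) := by
  let St := {p : List (ℕ × Set T) × Set ℕ //
    p.2 ⊆ M ∧ p.2.Infinite ∧ ∀ σ ∈ p.1, Rich (B · σ.1) σ.2 p.2}
  choose M' hM' hinf hrich using fun p : St => exists_extend_list B p.1.1 p.2.2.1 p.2.2.2
  let nn : St → ℕ := fun p => (hinf p).nonempty.some
  have hnn : ∀ p, nn p ∈ M' p := fun p => (hinf p).nonempty.some_mem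
  let nxt : ℕ → St → St := fun i p =>
    ⟨((i + 1, Φ (i + 1)) :: (p.1.1.map (fun σ => (σ.1, σ.2 ∩ B true σ.1 (nn p))) ++
      p.1.1.map (fun σ => (σ.1, σ.2 ∩ B false σ.1 (nn p)))), M' p \ Set.Iic (nn p)),
      Set.sdiff_subset.trans ((hM' p).trans p.2.1), (hinf p).sdiff (Set.finite_Iic _), by
        intro σ hσ
        simp only [List.mem_cons, List.mem_append, List.mem_map] at hσ
        rcases hσ with rfl | ⟨τ, hτ, rfl⟩ | ⟨τ, hτ, rfl⟩
        · exact (h _).mono (Set.sdiff_subset.trans ((hM' p).trans p.2.1))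
        · exact (hrich p τ hτ true _ (hnn p)).mono Set.sdiff_subset
        · exact (hrich p τ hτ false _ (hnn p)).mono Set.sdiff_subset⟩
  let S : ℕ → St := fun i => Nat.rec ⟨([(0, Φ 0)], M), subset_rfl, hM, by
    simpa using h 0⟩ nxt i
  have hS : ∀ i, S (i + 1) = nxt i (S i) := fun i => rfl
  have hanti : Antitone fun i => (S i).1.2 := antitone_nat_of_succ_le fun i => by
    rw [hS]
    exact Set.sdiff_subset.trans (hM' _)
  have hmem : ∀ i j, i ≤ j → nn (S j) ∈ (S i).1.2 := fun i j hij =>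
    hanti hij (hM' _ (hnn _))
  have hmono : StrictMono fun i => nn (S i) := strictMono_nat_of_lt_succ fun i => by
    have h1 := hmem (i + 1) (i + 1) le_rfl
    rw [hS] at h1
    rw [hS]
    simpa using h1.2
  have hbase : ∀ m, (m, Φ m) ∈ (S m).1.1 := fun m => by
    cases m with
    | zero => exact List.mem_singleton_self _
    | succ m => rw [hS]; exact List.mem_cons_self
  have hpat : ∀ m c i, (m, pattern (Φ m) (B · m) c (fun j => nn (S (m + j))) i) ∈
      (S (m + i)).1.1 := fun m c i => by
    induction i with
    | zero => exact hbase m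
    | succ i ih =>
      rw [← add_assoc, hS]
      refine List.mem_cons_of_mem _ (List.mem_append.2 ?_)
      rw [pattern]
      cases hc : c i
      · exact Or.inr (List.mem_map.2 ⟨_, ih, rfl⟩)
      · exact Or.inl (List.mem_map.2 ⟨_, ih, rfl⟩)
  refine ⟨fun i => nn (S i), hmono, fun i => (S i).2.1 (hmem i i le_rfl), fun m c i => ?_⟩
  refine ((S (m + i)).2.2.2 _ (hpat m c i)).of_tail (N := nn (S (m + i))) ?_
  rintro _ ⟨j, rfl⟩ hj
  exact hmem _ _ (hmono.le_iff_le.1 hj)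

theorem exists_diagonal (σ : ℕ → ℕ × Set T) {M : Set ℕ} (hM : M.Infinite)
    (h : ∀ i, Rich (B · (σ i).1) (σ i).2 M) :
    ∃ k : ℕ → ℕ, StrictMono k ∧ (∀ j, k j ∈ M) ∧
      ∀ i, ∃ t ∈ (σ i).2, ∀ᶠ j in atTop, t ∈ B true (σ i).1 (k j) := by
  let St := {Y : Set ℕ // Y ⊆ M ∧ Y.Infinite}
  choose t ht hb using fun (i : ℕ) (Y : St) => h i Y.1 Y.2.1 Y.2.2
  let nxt : ℕ → St → St := fun i Y => ⟨{n ∈ Y.1 | t i Y ∈ B true (σ i).1 n},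
    (Set.sep_subset _ _).trans Y.2.1, hb i Y true⟩
  let S : ℕ → St := fun i => Nat.rec ⟨M, subset_rfl, hM⟩ nxt i
  have hS : ∀ i, S (i + 1) = nxt i (S i) := fun i => rfl
  have hanti : Antitone fun i => (S i).1 := antitone_nat_of_succ_le fun i => Set.sep_subset _ _
  obtain ⟨k, hk, hkS⟩ := exists_strictMono_mem fun i => (S i).2.2
  refine ⟨k, hk, fun j => (S j).2.1 (hkS j), fun i => ⟨t i (S i), ht _ _, ?_⟩⟩
  filter_upwards [eventually_ge_atTop (i + 1)] with j hj
  have h1 : k j ∈ (S (i + 1)).1 := hanti hj (hkS j)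
  rw [hS] at h1
  exact h1.2

theorem exists_pattern_diagonal (Φ : ℕ → Set T) {M : Set ℕ} (hM : M.Infinite)
    (h : ∀ m, Rich (B · m) (Φ m) M) :
    ∃ n k : ℕ → ℕ, StrictMono n ∧ (∀ i, n i ∈ M) ∧ (∀ i, k i ∈ M) ∧ StrictMono k ∧
      ∀ (m : ℕ) (Q : Finset ℕ) (i : ℕ), ∃ t ∈ Φ m,
        (∀ j < i, t ∈ B (decide (j ∈ Q)) m (n (m + j))) ∧
          ∀ᶠ j in atTop, t ∈ B true m (k j) := by
  obtain ⟨n, hn, hnM, hr⟩ := exists_rich_pattern B Φ hM h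
  obtain ⟨e, he⟩ := exists_surjective_nat (ℕ × Finset ℕ × ℕ)
  obtain ⟨k, hk, hkM, ht⟩ := exists_diagonal B
    (fun q => ((e q).1, pattern (Φ (e q).1) (B · (e q).1) (fun j => decide (j ∈ (e q).2.1))
      (fun j => n ((e q).1 + j)) (e q).2.2))
    (Set.infinite_range_of_injective hn.injective) (fun q => hr _ _ _)
  refine ⟨n, k, hn, hnM, fun i => ?_, hk, fun m Q i => ?_⟩
  · obtain ⟨j, hj⟩ := hkM i
    exact hj ▸ hnM j
  · obtain ⟨q, hq⟩ := he (m, Q, i)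
    obtain ⟨t, htm, hev⟩ := ht q
    rw [hq] at htm hev
    obtain ⟨h1, h2⟩ := mem_pattern.1 htm
    exact ⟨t, h1, h2, hev⟩

end Diagonal

section Simons

/-- The support functional of a set of functionals. -/
def supOn (F : Set (X →L[ℝ] ℝ)) (x : X) : ℝ := sSup ((fun f : X →L[ℝ] ℝ => f x) '' F)

variable {F : Set (X →L[ℝ] ℝ)} {R : ℝ}

theorem le_supOn (hR : ∀ f ∈ F, ‖f‖ ≤ R) {f : X →L[ℝ] ℝ} (hf : f ∈ F) (x : X) :
    f x ≤ supOn F x := by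
  refine le_csSup ⟨R * ‖x‖, ?_⟩ ⟨f, hf, rfl⟩
  rintro _ ⟨g, hg, rfl⟩
  exact (Real.le_norm_self _).trans (g.le_of_opNorm_le (hR g hg) x)

theorem supOn_le (hF : F.Nonempty) {x : X} {a : ℝ} (h : ∀ f ∈ F, f x ≤ a) : supOn F x ≤ a :=
  csSup_le (hF.image _) (by rintro _ ⟨f, hf, rfl⟩; exact h f hf)

theorem supOn_le_add (hF : F.Nonempty) (hR : ∀ f ∈ F, ‖f‖ ≤ R) (x y : X) :
    supOn F x ≤ supOn F y + R * ‖x - y‖ := supOn_le hF fun f hf => by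
  have h1 := (Real.le_norm_self _).trans (f.le_of_opNorm_le (hR f hf) (x - y))
  have h2 := le_supOn hR hf y
  rw [map_sub] at h1
  linarith

theorem tendsto_supOn (hF : F.Nonempty) (hR : ∀ f ∈ F, ‖f‖ ≤ R) {v : ℕ → X} {s : X}
    (hv : Tendsto v atTop (𝓝 s)) : Tendsto (fun n => supOn F (v n)) atTop (𝓝 (supOn F s)) := by
  have hR0 : 0 ≤ R := hF.elim fun f hf => (norm_nonneg f).trans (hR f hf)
  have : LipschitzWith R.toNNReal (supOn F) := LipschitzWith.of_le_add_mul _ fun x y => by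
    rw [Real.coe_toNNReal R hR0, dist_eq_norm]
    exact supOn_le_add hF hR x y
  exact (this.continuous.tendsto s).comp hv

theorem exists_near_min {Z : Type*} {C : Set Z} (hC : C.Nonempty) {p : Z → ℝ} {a : ℝ}
    (ha : ∀ z ∈ C, a ≤ p z) {η : ℝ} (hη : 0 < η) : ∃ z ∈ C, ∀ z' ∈ C, p z ≤ p z' + η := by
  have hbdd : BddBelow (p '' C) := ⟨a, by rintro _ ⟨z, hz, rfl⟩; exact ha z hz⟩
  obtain ⟨_, ⟨z, hz, rfl⟩, hlt⟩ := exists_lt_of_csInf_lt (hC.image p)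
    (lt_add_of_pos_right (sInf (p '' C)) hη)
  exact ⟨z, hz, fun z' hz' => hlt.le.trans
    (add_le_add_left (csInf_le hbdd ⟨z', hz', rfl⟩) _)⟩

/-- A form of Simons' inequality. -/
theorem exists_frequently_lt [CompleteSpace X] {A : Set X} (hA : IsBounded A)
    (hF : IsBounded F)
    (hmax : ∀ z ∈ acoInf A, ∃ f ∈ F, ∀ g ∈ F, g z ≤ f z) {e : ℕ → X} (he : ∀ k, e k ∈ acoInf A)
    {c : ℝ} (hc : ∀ z ∈ convexHull ℝ (Set.range e), ∃ f ∈ F, c ≤ f z) {ε : ℝ} (hε : 0 < ε) :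
    ∃ f ∈ F, ∃ᶠ k in atTop, c - ε < f (e k) := by
  obtain ⟨R, hR⟩ := hF.exists_norm_le
  obtain ⟨D, hD⟩ := hA.exists_norm_le
  have hne : F.Nonempty := (hmax _ (he 0)).imp fun f hf => hf.1
  have hR0 : 0 ≤ R := hne.elim fun f hf => (norm_nonneg f).trans (hR f hf)
  let t : ℕ → ℝ := fun n => (1 / 2) ^ n
  have ht : ∀ n, 0 < t n := fun n => by positivity
  have hts : ∀ n, t (n + 1) = t n / 2 := fun n => by simp only [t, pow_succ]; ring
  let θ := ε / 4
  have hθ : 0 < θ := by positivity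
  let C : ℕ → Set X := fun n => convexHull ℝ (e '' Set.Ici n)
  have hCanti : Antitone C := fun m n hmn =>
    convexHull_mono (Set.image_mono (Set.Ici_subset_Ici.2 hmn))
  have hCaco : ∀ n, C n ⊆ acoInf A := fun n => convexHull_min
    (by rintro _ ⟨k, _, rfl⟩; exact he k) (convex_acoInf hA)
  have hCD : ∀ n, ∀ z ∈ C n, ‖z‖ ≤ D := fun n z hz => norm_le_of_mem_acoInf hD (hCaco n hz)
  have hCne : ∀ n, (C n).Nonempty := fun n => ⟨e n, subset_convexHull ℝ _ ⟨n, Set.self_mem_Ici, rfl⟩⟩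
  choose zz hzz hzmin using fun (n : ℕ) (w : X) => exists_near_min (hCne n)
    (p := fun z => supOn F (w + t n • z)) (a := -(R * (‖w‖ + t n * D))) (fun z hz => by
      obtain ⟨f, hf⟩ := hne
      refine le_trans ?_ (le_supOn hR hf _)
      have h1 := f.le_of_opNorm_le (hR f hf) (w + t n • z)
      have h2 : ‖w + t n • z‖ ≤ ‖w‖ + t n * D := (norm_add_le _ _).trans (by
        rw [norm_smul, Real.norm_of_nonneg (ht n).le]
        gcongr
        exact hCD n z hz)
      have h3 := mul_le_mul_of_nonneg_left h2 hR0
      have h4 := neg_abs_le (f (w + t n • z))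
      rw [Real.norm_eq_abs] at h1
      linarith) (η := θ * t n ^ 2) (by have := ht n; positivity)
  let w : ℕ → X := fun n => Nat.rec 0 (fun n v => v + t (n + 1) • zz n v) n
  let z : ℕ → X := fun n => zz n (w n)
  have hw : ∀ n, w (n + 1) = w n + t (n + 1) • z n := fun n => rfl
  have hz : ∀ n, z n ∈ C n := fun n => hzz _ _
  let Q : ℕ → X := fun n => w n + t n • z n
  have htail : ∀ n N, n ≤ N → ∀ r ∈ C N, ∃ r' ∈ C n, w N + t N • r = w n + t n • r' := by
    intro n N hN
    induction N, hN using Nat.le_induction with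
    | base => exact fun r hr => ⟨r, hr, rfl⟩
    | succ N hN ih =>
      intro r hr
      obtain ⟨r', hr', h⟩ := ih ((1 / 2 : ℝ) • z N + (1 / 2 : ℝ) • r)
        (convex_convexHull ℝ _ (hz N) (hCanti N.le_succ hr) (by norm_num) (by norm_num)
          (by norm_num))
      refine ⟨r', hr', ?_⟩
      rw [← h, hw, hts]
      module
  have hcoef : HasSum (fun n => t (n + 1)) 1 := by
    have := hasSum_geometric_two.mul_left (1 / 2)
    norm_num at this
    refine this.congr_fun fun n => ?_
    rw [hts]
    simp only [t]
    ring
  have hsum : Summable fun n => t (n + 1) • z n :=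
    Summable.of_norm_bounded (hcoef.summable.mul_right D) fun n => by
      rw [norm_smul, Real.norm_of_nonneg (ht _).le]
      exact mul_le_mul_of_nonneg_left (hCD n _ (hz n)) (ht _).le
  obtain ⟨S, hS⟩ := hsum
  have hSaco : S ∈ acoInf A := hasSum_mem_acoInf hA (fun n => hCaco n (hz n))
    (by simpa only [abs_of_pos (ht _)] using hcoef) hS
  have hwS : Tendsto w atTop (𝓝 S) := by
    refine hS.tendsto_sum_nat.congr fun n => ?_
    induction n with
    | zero => rfl
    | succ n ih => rw [Finset.sum_range_succ, ih, hw]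
  have hQS : Tendsto Q atTop (𝓝 S) := by
    have h0 : Tendsto (fun n => t n • z n) atTop (𝓝 0) := by
      have := (hS.summable.tendsto_atTop_zero).const_smul (2 : ℝ)
      rw [smul_zero] at this
      refine this.congr fun n => ?_
      rw [hts, smul_smul]
      congr 1
      ring
    simpa using hwS.add h0
  have hPQ := tendsto_supOn hne hR hQS
  have hPS : c ≤ supOn F S := by
    refine ge_of_tendsto' hPQ fun N => ?_
    obtain ⟨r, hr, h⟩ := htail 0 N (Nat.zero_le _) (z N) (hz N)
    obtain ⟨f, hf, hcf⟩ := hc r (convexHull_mono (Set.image_subset_range _ _) hr)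
    have : Q N = r := by
      change w N + t N • z N = r
      rw [h]
      simp [w, t]
    rw [this]
    exact hcf.trans (le_supOn hR hf r)
  have hQle : ∀ n, supOn F (Q n) ≤ supOn F S + θ * t n ^ 2 := fun n => by
    refine ge_of_tendsto (hPQ.add_const _) ?_
    filter_upwards [eventually_ge_atTop n] with N hN
    obtain ⟨r, hr, h⟩ := htail n N hN (z N) (hz N)
    change _ ≤ supOn F (w N + t N • z N) + _
    rw [h]
    exact hzmin n (w n) r hr
  have hgap : ∀ n, t n * (supOn F S - 2 * θ * (1 - t n)) ≤ supOn F S - supOn F (w n) := by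
    intro n
    induction n with
    | zero =>
      have : supOn F (w 0) ≤ 0 := supOn_le hne fun f _ => by simp [w]
      simp only [t, pow_zero]
      linarith
    | succ n ih =>
      have h1 : supOn F (w (n + 1)) ≤ supOn F (w n) / 2 + supOn F (Q n) / 2 :=
        supOn_le hne fun f hf => by
          have h2 := le_supOn hR hf (w n)
          have h3 := le_supOn hR hf (Q n)
          simp only [Q, map_add, map_smul, smul_eq_mul] at h3
          rw [hw, hts]
          simp only [map_add, map_smul, smul_eq_mul]
          linarith
      have h2 := hQle n
      rw [hts]
      nlinarith
  obtain ⟨f, hf, hfmax⟩ := hmax S hSaco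
  refine ⟨f, hf, fun hev => ?_⟩
  obtain ⟨n, hn⟩ := eventually_atTop.1 hev
  have hCle : ∀ r ∈ C n, f r ≤ c - ε := fun r hr => by
    have : C n ⊆ {r | f r ≤ c - ε} := convexHull_min
      (by rintro _ ⟨k, hk, rfl⟩; exact not_lt.1 (hn k hk))
      (convex_halfSpace_le f.toLinearMap.isLinear _)
    exact this hr
  have hfS : f S ≤ f (w n) + t n * (c - ε) := by
    refine le_of_tendsto ((f.continuous.tendsto S).comp hQS) ?_
    filter_upwards [eventually_ge_atTop n] with N hN
    obtain ⟨r, hr, h⟩ := htail n N hN (z N) (hz N)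
    change f (w N + t N • z N) ≤ _
    rw [h, map_add, map_smul, smul_eq_mul]
    have := mul_le_mul_of_nonneg_left (hCle r hr) (ht n).le
    linarith
  have h1 := hgap n
  have h2 : supOn F S ≤ f S := supOn_le hne hfmax
  have h3 := le_supOn hR hf (w n)
  have h4 : ε = 4 * θ := by simp only [θ]; ring
  have h5 := ht n
  nlinarith [mul_le_mul_of_nonneg_left hPS h5.le, mul_pos h5 hθ, mul_pos h5 h5,
    mul_pos (mul_pos h5 h5) hθ]

end Simons

section Stabilization

theorem exists_stable_range {g : Set ℕ → ℝ} (hg : ∀ S, S.Infinite → 0 ≤ g S)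
    (hmono : ∀ S S' N, S'.Infinite → (∀ n ∈ S', N ≤ n → n ∈ S) → g S' ≤ g S) :
    ∃ k : ℕ → ℕ, StrictMono k ∧ ∀ S ⊆ Set.range k, S.Infinite → g S = g (Set.range k) := by
  let St := {S : Set ℕ // S.Infinite}
  choose nxt hnxt hmin using fun (j : ℕ) (S : St) => exists_near_min
    (C := {S' : Set ℕ | S' ⊆ S.1 ∧ S'.Infinite}) ⟨S.1, subset_rfl, S.2⟩ (p := g) (a := 0)
    (fun S' h => hg S' h.2) (η := 1 / ((j : ℝ) + 1)) Nat.one_div_pos_of_nat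
  let S : ℕ → St := fun j => Nat.rec ⟨Set.univ, Set.infinite_univ⟩
    (fun j S => ⟨nxt j S, (hnxt j S).2⟩) j
  have hS : ∀ j, (S (j + 1)).1 = nxt j (S j) := fun j => rfl
  have hanti : Antitone fun j => (S j).1 := antitone_nat_of_succ_le fun j => (hnxt j (S j)).1
  obtain ⟨k, hk, hkS⟩ := exists_strictMono_mem fun j => (S j).2
  have htail : ∀ j, ∀ n ∈ Set.range k, k j ≤ n → n ∈ (S j).1 := by
    rintro j _ ⟨i, rfl⟩ hi
    exact hanti (hk.le_iff_le.1 hi) (hkS i)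
  have hrange : (Set.range k).Infinite := Set.infinite_range_of_injective hk.injective
  refine ⟨k, hk, fun Y hY hinf => le_antisymm (hmono _ _ 0 hinf fun n hn _ => hY hn) ?_⟩
  refine le_of_forall_pos_le_add fun η hη => ?_
  obtain ⟨j, hj⟩ := exists_nat_one_div_lt hη
  have hYj := infinite_inter_of_tail hinf fun n hn => htail j n (hY hn)
  calc g (Set.range k) ≤ g (S (j + 1)).1 := hmono _ _ _ hrange (htail (j + 1))
    _ ≤ g (Y ∩ (S j).1) + 1 / ((j : ℝ) + 1) := hmin j (S j) _ ⟨Set.inter_subset_right, hYj⟩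
    _ ≤ g Y + η := add_le_add (hmono _ _ 0 hYj fun n hn _ => hn.1) hj.le

/-- Passing to a subsequence on which the oscillation `limsup - liminf`, maximised over the index
set, takes the same value `δ` along every further subsequence. -/
theorem exists_stable_oscillation {T : Type*} [Nonempty T] {a : T → ℕ → ℝ} {D : ℝ}
    (hD : ∀ t k, |a t k| ≤ D) :
    ∃ (φ : ℕ → ℕ) (δ : ℝ), StrictMono φ ∧
      (∀ t, ∀ η > 0, ∃ N, ∀ k ≥ N, ∀ l ≥ N, a t (φ k) - a t (φ l) ≤ δ + η) ∧
      ∀ Y : Set ℕ, Y.Infinite → ∀ ε > 0, ∃ t, ∀ N, ∃ k ∈ Y, ∃ l ∈ Y, N ≤ k ∧ N ≤ l ∧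
        δ - ε < a t (φ k) - a t (φ l) := by
  let V : Set ℕ → Set ℝ := fun S => {d | ∀ t, ∀ η > 0, ∃ N, ∀ k ∈ S, ∀ l ∈ S, N ≤ k → N ≤ l →
    a t k - a t l ≤ d + η}
  have hV0 : ∀ S : Set ℕ, S.Infinite → ∀ d ∈ V S, 0 ≤ d := fun S hS d hd => by
    refine le_of_forall_pos_le_add fun η hη => ?_
    obtain ⟨t⟩ := ‹Nonempty T›
    obtain ⟨N, hN⟩ := hd t η hη
    obtain ⟨k, hk, hlt⟩ := hS.exists_gt N
    simpa using hN k hk k hk hlt.le hlt.le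
  have hVne : ∀ S, (V S).Nonempty := fun S => ⟨2 * D, fun t η hη => ⟨0, fun k _ l _ _ _ => by
    have h1 := (abs_le.1 (hD t k)).2
    have h2 := (abs_le.1 (hD t l)).1
    linarith⟩⟩
  have hVmono : ∀ S S' N, (∀ n ∈ S', N ≤ n → n ∈ S) → V S ⊆ V S' := fun S S' N h d hd t η hη => by
    obtain ⟨N', hN'⟩ := hd t η hη
    exact ⟨max N N', fun k hk l hl hNk hNl => hN' k (h k hk (le_of_max_le_left hNk)) l
      (h l hl (le_of_max_le_left hNl)) (le_of_max_le_right hNk) (le_of_max_le_right hNl)⟩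
  obtain ⟨φ, hφ, hst⟩ := exists_stable_range (g := fun S => sInf (V S))
    (fun S hS => Real.sInf_nonneg (hV0 S hS))
    (fun S S' N hS' h => csInf_le_csInf ⟨0, hV0 S' hS'⟩ (hVne S) (hVmono S S' N h))
  refine ⟨φ, sInf (V (Set.range φ)), hφ, fun t η hη => ?_, fun Y hY ε hε => ?_⟩
  · obtain ⟨d, hd, hlt⟩ := exists_lt_of_csInf_lt (hVne (Set.range φ))
      (lt_add_of_pos_right (sInf (V (Set.range φ))) (half_pos hη))
    obtain ⟨N, hN⟩ := hd t (η / 2) (half_pos hη)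
    refine ⟨N, fun k hk l hl => ?_⟩
    have := hN (φ k) ⟨k, rfl⟩ (φ l) ⟨l, rfl⟩ (hk.le.trans hφ.le_apply) (hl.le.trans hφ.le_apply)
    linarith
  · have hYinf : (φ '' Y).Infinite := hY.image hφ.injective.injOn
    have hnot : sInf (V (Set.range φ)) - ε ∉ V (φ '' Y) := fun h => by
      have h1 := csInf_le ⟨0, hV0 _ hYinf⟩ h
      have h2 : sInf (V (φ '' Y)) = sInf (V (Set.range φ)) :=
        hst _ (Set.image_subset_range _ _) hYinf
      linarith
    simp only [V, Set.mem_ofPred_eq, not_forall, not_exists, not_le] at hnot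
    obtain ⟨t, η, hη, h⟩ := hnot
    refine ⟨t, fun N => ?_⟩
    obtain ⟨_, ⟨k, hk, rfl⟩, _, ⟨l, hl, rfl⟩, hNk, hNl, hlt⟩ := h (φ N)
    exact ⟨k, hk, l, hl, hφ.le_iff_le.1 hNk, hφ.le_iff_le.1 hNl, by linarith⟩

end Stabilization

section Oscillation

theorem le_of_mapClusterPt {s : ℕ → ℝ} {a c : ℝ} (h : MapClusterPt a atTop s)
    (hs : ∀ᶠ n in atTop, s n ≤ c) : a ≤ c :=
  isClosed_Iic.mem_of_mapClusterPt h hs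

theorem ge_of_mapClusterPt {s : ℕ → ℝ} {a c : ℝ} (h : MapClusterPt a atTop s)
    (hs : ∀ᶠ n in atTop, c ≤ s n) : c ≤ a :=
  isClosed_Ici.mem_of_mapClusterPt h hs

/-- Every `f ∈ F` eventually maps `u` close to `[α f, α f + δ]`, and along every subsequence some
`f ∈ F` oscillates by nearly `δ`. -/
structure IsOscillating (A : Set X) (F : Set (X →L[ℝ] ℝ)) (u : ℕ → X) (α : (X →L[ℝ] ℝ) → ℝ)
    (δ : ℝ) : Prop where
  bdd : IsBounded A
  bddF : IsBounded F
  attains : ∀ z ∈ acoInf A, ∃ f ∈ F, ∀ g ∈ F, g z ≤ f z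
  cluster : ∀ v : ℕ → X, (∀ n, v n ∈ A) →
    ∃ x ∈ A, ∀ f ∈ F, MapClusterPt (f x) atTop fun n => f (v n)
  mem : ∀ n, u n ∈ A
  pos : 0 < δ
  near : ∀ f ∈ F, ∀ η > 0, ∀ᶠ k in atTop, α f - η ≤ f (u k) ∧ f (u k) ≤ α f + δ + η
  osc : ∀ Y : Set ℕ, Y.Infinite → ∀ ε > 0, ∃ f ∈ F, ∀ N, ∃ k ∈ Y, ∃ l ∈ Y, N ≤ k ∧ N ≤ l ∧
    δ - ε < f (u k) - f (u l)

/-- The functionals that are nearly maximal (for `true`) or nearly minimal (for `false`) at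
`u n`. -/
def nearExt (u : ℕ → X) (α : (X →L[ℝ] ℝ) → ℝ) (δ : ℝ) : Bool → ℕ → ℕ → Set (X →L[ℝ] ℝ)
  | true, m, n => {f | α f + δ - 1 / ((m : ℝ) + 1) ≤ f (u n)}
  | false, m, n => {f | f (u n) ≤ α f + 1 / ((m : ℝ) + 1)}

/-- The functionals in `F` that are nearly maximal at `w`. -/
def nearTop (F : Set (X →L[ℝ] ℝ)) (α : (X →L[ℝ] ℝ) → ℝ) (δ : ℝ) (w : X) (m : ℕ) :
    Set (X →L[ℝ] ℝ) :=
  {f | f ∈ F ∧ α f + δ - 1 / ((m : ℝ) + 1) ≤ f w}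

variable {A : Set X} {F : Set (X →L[ℝ] ℝ)} {u : ℕ → X} {α : (X →L[ℝ] ℝ) → ℝ} {δ : ℝ}

namespace IsOscillating

theorem rich_univ (h : IsOscillating A F u α δ) (m : ℕ) :
    Rich (nearExt u α δ · m) F Set.univ := fun Y _ hY => by
  have hpos : (0 : ℝ) < 1 / ((m : ℝ) + 1) := Nat.one_div_pos_of_nat
  obtain ⟨f, hf, hosc⟩ := h.osc Y hY _ (half_pos hpos)
  obtain ⟨N₀, hN₀⟩ := eventually_atTop.1 (h.near f hf _ (half_pos hpos))
  refine ⟨f, hf, fun b => Set.infinite_of_not_bddAbove fun ⟨N, hN⟩ => ?_⟩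
  obtain ⟨k, hk, l, hl, hNk, hNl, hlt⟩ := hosc (max N₀ (N + 1))
  have h1 := (hN₀ k (le_of_max_le_left hNk)).2
  have h2 := (hN₀ l (le_of_max_le_left hNl)).1
  cases b
  · have : l ≤ N := hN ⟨hl, show f (u l) ≤ α f + 1 / ((m : ℝ) + 1) by linarith⟩
    have := le_of_max_le_right hNl
    omega
  · have : k ≤ N := hN ⟨hk, show α f + δ - 1 / ((m : ℝ) + 1) ≤ f (u k) by linarith⟩
    have := le_of_max_le_right hNk
    omega

theorem exists_cluster (h : IsOscillating A F u α δ) {Φ : ℕ → Set (X →L[ℝ] ℝ)}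
    (hΦ : ∀ m, Φ m ⊆ F) {M : Set ℕ} (hM : M.Infinite)
    (hr : ∀ m, Rich (nearExt u α δ · m) (Φ m) M) :
    ∃ n : ℕ → ℕ, StrictMono n ∧ (∀ i, n i ∈ M) ∧ ∃ y ∈ A,
      (∀ f ∈ F, α f ≤ f y ∧ f y ≤ α f + δ) ∧
      (∀ f ∈ F, ∀ c, (∀ k ∈ M, f (u k) ≤ c) → f y ≤ c) ∧
      ∀ (m : ℕ) (Q : Finset ℕ) (i : ℕ), ∃ f ∈ Φ m, α f + δ - 1 / ((m : ℝ) + 1) ≤ f y ∧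
        ∀ j < i, f ∈ nearExt u α δ (decide (j ∈ Q)) m (n (m + j)) := by
  obtain ⟨n, k, hn, hnM, hkM, hk, hpat⟩ := exists_pattern_diagonal _ Φ hM hr
  obtain ⟨y, hy, hcl⟩ := h.cluster (fun i => u (k i)) fun i => h.mem _
  refine ⟨n, hn, hnM, y, hy, fun f hf => ⟨?_, ?_⟩, fun f hf c hc => ?_, fun m Q i => ?_⟩
  · refine le_of_forall_pos_le_add fun η hη => ?_
    have := ge_of_mapClusterPt (hcl f hf)
      ((hk.tendsto_atTop.eventually (h.near f hf η hη)).mono fun j hj => hj.1)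
    linarith
  · exact le_of_forall_pos_le_add fun η hη => le_of_mapClusterPt (hcl f hf)
      ((hk.tendsto_atTop.eventually (h.near f hf η hη)).mono fun j hj => hj.2)
  · exact le_of_mapClusterPt (hcl f hf) (Eventually.of_forall fun j => hc _ (hkM j))
  · obtain ⟨f, hf, hpf, hev⟩ := hpat m Q i
    exact ⟨f, hf, ge_of_mapClusterPt (hcl f (hΦ m hf)) hev, hpf⟩

theorem exists_le_on_convexHull {e : ℕ → X} {c : ℝ}
    (hfin : ∀ K, ∃ f ∈ F, ∀ k < K, c ≤ f (e k)) {z : X}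
    (hz : z ∈ convexHull ℝ (Set.range e)) : ∃ f ∈ F, c ≤ f z := by
  let W : Set X := {z | ∃ K, ∀ f ∈ F, (∀ k < K, c ≤ f (e k)) → c ≤ f z}
  have hW : convexHull ℝ (Set.range e) ⊆ W := by
    refine convexHull_min ?_ ?_
    · rintro _ ⟨k, rfl⟩
      exact ⟨k + 1, fun f _ h => h k k.lt_succ_self⟩
    · rintro x ⟨K, hK⟩ y ⟨K', hK'⟩ a b ha hb hab
      refine ⟨max K K', fun f hf h => ?_⟩
      exact convex_halfSpace_ge f.toLinearMap.isLinear c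
        (hK f hf fun k hk => h k (lt_max_of_lt_left hk))
        (hK' f hf fun k hk => h k (lt_max_of_lt_right hk)) ha hb hab
  obtain ⟨K, hK⟩ := hW hz
  obtain ⟨f, hf, hfK⟩ := hfin K
  exact ⟨f, hf, hK f hf hfK⟩

theorem rich_nearTop [CompleteSpace X] (h : IsOscillating A F u α δ) {w : X} (hw : w ∈ acoInf A)
    (hwle : ∀ f ∈ F, f w ≤ α f + δ) {n : ℕ → ℕ} (hn : StrictMono n)
    (hpat : ∀ (m : ℕ) (Q : Finset ℕ) (i : ℕ), ∃ f ∈ F, α f + δ - 1 / ((m : ℝ) + 1) ≤ f w ∧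
      ∀ j < i, f ∈ nearExt u α δ (decide (j ∈ Q)) m (n (m + j))) (m : ℕ) :
    Rich (nearExt u α δ · m) (nearTop F α δ w m) (Set.range n) := fun Y hY hinf => by
  let m' := 11 * m + 10
  let ε : ℝ := 1 / ((m' : ℝ) + 1)
  have hε : 0 < ε := Nat.one_div_pos_of_nat
  have hm : 1 / ((m : ℝ) + 1) = 11 * ε := by
    simp only [ε, m']
    push_cast
    field_simp
    ring
  have hZ : {j | n (m' + j) ∈ Y}.Infinite := fun hfin => by
    refine hinf (((Set.finite_Iio m').image n).union (hfin.image fun j => n (m' + j))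
      |>.subset fun k hk => ?_)
    obtain ⟨i, rfl⟩ := hY hk
    rcases lt_or_ge i m' with hi | hi
    · exact Or.inl ⟨i, hi, rfl⟩
    · refine Or.inr ⟨i - m', ?_, ?_⟩
      · change n (m' + (i - m')) ∈ Y
        rwa [Nat.add_sub_cancel' hi]
      · change n (m' + (i - m')) = n i
        rw [Nat.add_sub_cancel' hi]
  obtain ⟨ψ, hψ, hψY⟩ := exists_strictMono_mem fun _ => hZ
  let hi : ℕ → ℕ := fun k => n (m' + ψ (2 * k))
  let lo : ℕ → ℕ := fun k => n (m' + ψ (2 * k + 1))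
  have hhi : StrictMono hi := fun a b hab => hn (by have := hψ (show 2 * a < 2 * b by omega); omega)
  have hlo : StrictMono lo := fun a b hab =>
    hn (by have := hψ (show 2 * a + 1 < 2 * b + 1 by omega); omega)
  let e : ℕ → X := fun k =>
    (1 / 2 : ℝ) • ((1 / 2 : ℝ) • w + (1 / 2 : ℝ) • u (hi k)) + (-(1 / 2) : ℝ) • u (lo k)
  have hfe : ∀ (f : X →L[ℝ] ℝ) k,
      f (e k) = 1 / 2 * (1 / 2 * f w + 1 / 2 * f (u (hi k))) + -(1 / 2) * f (u (lo k)) :=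
    fun f k => by simp only [e, map_add, map_smul, smul_eq_mul]
  have he : ∀ k, e k ∈ acoInf A := fun k =>
    smul_add_smul_mem_acoInf h.bdd (by norm_num [abs_of_pos])
      (convex_acoInf h.bdd hw (subset_acoInf A (h.mem _)) (by norm_num) (by norm_num)
        (by norm_num)) (subset_acoInf A (h.mem _))
  have hhull : ∀ z ∈ convexHull ℝ (Set.range e), ∃ f ∈ F, δ / 2 - ε ≤ f z := fun z hz => by
    refine exists_le_on_convexHull (fun K => ?_) hz
    obtain ⟨f, hf, hfw, hfp⟩ := hpat m' ((Finset.range K).image fun k => ψ (2 * k)) (ψ (2 * K))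
    refine ⟨f, hf, fun k hk => ?_⟩
    have h1 := hfp (ψ (2 * k)) (hψ (by omega))
    have h2 := hfp (ψ (2 * k + 1)) (hψ (by omega))
    rw [decide_eq_true (Finset.mem_image.2 ⟨k, Finset.mem_range.2 hk, rfl⟩)] at h1
    rw [decide_eq_false (fun hmem => by
      obtain ⟨k', -, hk'⟩ := Finset.mem_image.1 hmem
      have := hψ.injective hk'
      omega)] at h2
    change α f + δ - ε ≤ f (u (hi k)) at h1
    change f (u (lo k)) ≤ α f + ε at h2
    change α f + δ - ε ≤ f w at hfw
    rw [hfe]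
    linarith
  obtain ⟨f, hf, hfreq⟩ := exists_frequently_lt h.bdd h.bddF h.attains he hhull hε
  have hev := h.near f hf ε hε
  have hfreq' := hfreq.and_eventually
    ((hhi.tendsto_atTop.eventually hev).and (hlo.tendsto_atTop.eventually hev))
  have hw' := hwle f hf
  have hall : ∃ᶠ k in atTop, α f + δ - 1 / ((m : ℝ) + 1) ≤ f w ∧
      α f + δ - 1 / ((m : ℝ) + 1) ≤ f (u (hi k)) ∧ f (u (lo k)) ≤ α f + 1 / ((m : ℝ) + 1) := by
    refine hfreq'.mono fun k hk => ?_
    obtain ⟨hk, ⟨h1, h2⟩, h3, h4⟩ := hk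
    rw [hfe] at hk
    rw [hm]
    refine ⟨?_, ?_, ?_⟩ <;> linarith
  refine ⟨f, ⟨hf, hall.exists.elim fun k hk => hk.1⟩, fun b => ?_⟩
  rw [Nat.frequently_atTop_iff_infinite] at hall
  cases b
  · refine (hall.image hlo.injective.injOn).mono ?_
    rintro _ ⟨k, hk, rfl⟩
    exact ⟨hψY _, hk.2.2⟩
  · refine (hall.image hhi.injective.injOn).mono ?_
    rintro _ ⟨k, hk, rfl⟩
    exact ⟨hψY _, hk.2.1⟩

theorem exists_next [CompleteSpace X] (h : IsOscillating A F u α δ) {w : X} {S : Set ℕ}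
    (hS : S.Infinite) (hw : w ∈ acoInf A) (hwle : ∀ f ∈ F, f w ≤ α f + δ)
    (hr : ∀ m, Rich (nearExt u α δ · m) (nearTop F α δ w m) S) {ε : ℝ} (hε : 0 < ε) :
    ∃ f ∈ F, ∃ y ∈ A, ∃ S' ⊆ S, S'.Infinite ∧ α f + δ - ε ≤ f w ∧
      (∀ k ∈ S', f (u k) ≤ α f + ε) ∧ f y ≤ α f + ε ∧ (∀ g ∈ F, α g ≤ g y ∧ g y ≤ α g + δ) ∧
      (∀ g ∈ F, ∀ c, (∀ k ∈ S, g (u k) ≤ c) → g y ≤ c) ∧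
      ∀ m, Rich (nearExt u α δ · m)
        (nearTop F α δ ((1 / 2 : ℝ) • w + (1 / 2 : ℝ) • y) m) S' := by
  obtain ⟨m, hm⟩ := exists_nat_one_div_lt hε
  obtain ⟨f, ⟨hf, hfw⟩, hinf⟩ := hr m S subset_rfl hS
  have hM : {k ∈ S | f ∈ nearExt u α δ false m k} ⊆ S := Set.sep_subset _ _
  obtain ⟨n, hn, hnM, y, hy, hyle, hycl, hpat⟩ := h.exists_cluster
    (Φ := nearTop F α δ w) (fun m g hg => hg.1) (hinf false) fun m => (hr m).mono hM
  have hfM : ∀ k ∈ {k ∈ S | f ∈ nearExt u α δ false m k}, f (u k) ≤ α f + ε := fun k hk => by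
    have : f (u k) ≤ α f + 1 / ((m : ℝ) + 1) := hk.2
    linarith
  refine ⟨f, hf, y, hy, Set.range n, ?_, Set.infinite_range_of_injective hn.injective, by linarith,
    ?_, hycl f hf _ hfM, hyle, fun g hg c hc => hycl g hg c fun k hk => hc k hk.1, ?_⟩
  · rintro _ ⟨i, rfl⟩
    exact (hnM i).1
  · rintro _ ⟨i, rfl⟩
    exact hfM _ (hnM i)
  · refine h.rich_nearTop (convex_acoInf h.bdd hw (subset_acoInf A hy) (by norm_num)
      (by norm_num) (by norm_num)) (fun g hg => ?_) hn fun m Q i => ?_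
    · have := hwle g hg
      have := (hyle g hg).2
      simp only [map_add, map_smul, smul_eq_mul]
      linarith
    · obtain ⟨g, ⟨hg, hgw⟩, hgy, hgp⟩ := hpat m Q i
      refine ⟨g, hg, ?_, hgp⟩
      simp only [map_add, map_smul, smul_eq_mul]
      linarith

/-- There are `y n ∈ A` that are separated by some `f N ∈ F` at each `N`. -/
theorem exists_separated [CompleteSpace X] (h : IsOscillating A F u α δ) :
    ∃ (y : ℕ → X) (f : ℕ → X →L[ℝ] ℝ), (∀ n, y n ∈ A) ∧ (∀ N, f N ∈ F) ∧
      (∀ n, ∀ g ∈ F, α g ≤ g (y n) ∧ g (y n) ≤ α g + δ) ∧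
      (∀ N, ∀ n ≤ N, α (f N) + δ - 2 * (1 / 2) ^ N ≤ f N (y n)) ∧
      ∀ N, ∀ n > N, f N (y n) ≤ α (f N) + (1 / 2) ^ N := by
  let St := {p : X × Set ℕ // p.2.Infinite ∧ p.1 ∈ acoInf A ∧ (∀ f ∈ F, f p.1 ≤ α f + δ) ∧
    ∀ m, Rich (nearExt u α δ · m) (nearTop F α δ p.1 m) p.2}
  choose f hf y hy S' hS' hinf htop hlow hylow hyle hycl hrich using fun (N : ℕ) (p : St) =>
    h.exists_next p.2.1 p.2.2.1 p.2.2.2.1 p.2.2.2.2 (ε := (1 / 4 : ℝ) ^ N) (by positivity)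
  obtain ⟨n₀, hn₀, -, y₀, hy₀, hyle₀, -, hpat₀⟩ := h.exists_cluster (Φ := fun _ => F)
    (fun _ => subset_rfl) Set.infinite_univ h.rich_univ
  let nxt : ℕ → St → St := fun N p => ⟨((1 / 2 : ℝ) • p.1.1 + (1 / 2 : ℝ) • y N p, S' N p),
    hinf N p, convex_acoInf h.bdd p.2.2.1 (subset_acoInf A (hy N p)) (by norm_num) (by norm_num)
      (by norm_num), fun g hg => by
        have := p.2.2.2.1 g hg
        have := (hyle N p g hg).2
        simp only [map_add, map_smul, smul_eq_mul]
        linarith, hrich N p⟩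
  let p : ℕ → St := fun N => Nat.rec ⟨(y₀, Set.range n₀),
    Set.infinite_range_of_injective hn₀.injective, subset_acoInf A hy₀,
      fun g hg => (hyle₀ g hg).2,
      h.rich_nearTop (subset_acoInf A hy₀) (fun g hg => (hyle₀ g hg).2) hn₀ hpat₀⟩ nxt N
  have hp : ∀ N, p (N + 1) = nxt N (p N) := fun N => rfl
  let Y : ℕ → X := fun n => Nat.casesOn n y₀ fun n => y n (p n)
  have hY : ∀ n, Y (n + 1) = y n (p n) := fun n => rfl
  have hYA : ∀ n, Y n ∈ A := fun n => by
    cases n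
    · exact hy₀
    · exact hy _ _
  have hYle : ∀ n, ∀ g ∈ F, α g ≤ g (Y n) ∧ g (Y n) ≤ α g + δ := fun n => by
    cases n
    · exact hyle₀
    · exact hyle _ _
  have hanti : Antitone fun N => (p N).1.2 := antitone_nat_of_succ_le fun N => hS' N (p N)
  have hback : ∀ N, ∀ g ∈ F, ∀ e : ℝ, α g + δ - e ≤ g (p N).1.1 →
      ∀ n ≤ N, α g + δ - 2 ^ (N + 1) * e ≤ g (Y n) := by
    intro N
    induction N with
    | zero =>
      intro g hg e he n hn
      obtain rfl : n = 0 := by omega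
      have h1 := (hyle₀ g hg).2
      change α g + δ - e ≤ g y₀ at he
      change _ ≤ g y₀
      norm_num
      linarith
    | succ N ih =>
      intro g hg e he n hn
      have h1 := (p N).2.2.2.1 g hg
      have h2 := (hYle (N + 1) g hg).2
      have h3 : g (p (N + 1)).1.1 = 1 / 2 * g (p N).1.1 + 1 / 2 * g (Y (N + 1)) := by
        rw [hp, hY]
        simp only [nxt, map_add, map_smul, smul_eq_mul]
      rw [h3] at he
      have he0 : 0 ≤ e := by linarith
      rcases Nat.lt_or_ge n (N + 1) with hlt | hge
      · have := ih g hg (2 * e) (by linarith) n (by omega)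
        rw [pow_succ _ (N + 1)]
        linarith
      · obtain rfl : n = N + 1 := by omega
        have : (1 : ℝ) ≤ 2 ^ (N + 1) := one_le_pow₀ one_le_two
        rw [pow_succ _ (N + 1)]
        nlinarith
  refine ⟨Y, fun N => f N (p N), hYA, fun N => hf _ _, hYle, fun N n hn => ?_, fun N n hn => ?_⟩
  · have h1 := hback N _ (hf N (p N)) _ (htop N (p N)) n hn
    have h2 : (2 : ℝ) ^ (N + 1) * (1 / 4) ^ N = 2 * (1 / 2) ^ N := by
      rw [pow_succ, mul_right_comm, ← mul_pow, mul_comm]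
      norm_num
    rwa [h2] at h1
  · have hle : (1 / 4 : ℝ) ^ N ≤ (1 / 2) ^ N := by gcongr; norm_num
    suffices f N (p N) (Y n) ≤ α (f N (p N)) + (1 / 4) ^ N by linarith
    obtain ⟨n, rfl⟩ := Nat.exists_eq_succ_of_ne_zero (Nat.ne_zero_of_lt hn)
    rw [Nat.succ_eq_add_one, hY]
    rcases Nat.lt_or_ge N n with hlt | hge
    · exact hycl n (p n) _ (hf N (p N)) _ fun k hk =>
        hlow N (p N) k (hanti (Nat.succ_le_of_lt hlt) hk)
    · obtain rfl : n = N := by omega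
      exact hylow n (p n)

protected theorem false [CompleteSpace X] (h : IsOscillating A F u α δ) : False := by
  obtain ⟨y, f, hyA, hf, hyle, htop, hlow⟩ := h.exists_separated
  obtain ⟨x, hx, hcl⟩ := h.cluster y hyA
  have hδ := h.pos
  let d : ℕ → X := fun n => (1 / 2 : ℝ) • y n + (-(1 / 2) : ℝ) • x
  have hd : ∀ n, d n ∈ acoInf A := fun n => smul_add_smul_mem_acoInf h.bdd
    (by norm_num [abs_of_pos]) (subset_acoInf A (hyA n)) (subset_acoInf A hx)
  have hgd : ∀ (g : X →L[ℝ] ℝ) n, g (d n) = 1 / 2 * (g (y n) - g x) := fun g n => by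
    simp only [d, map_add, map_smul, smul_eq_mul]
    ring
  have hxle : ∀ g ∈ F, α g ≤ g x ∧ g x ≤ α g + δ := fun g hg =>
    ⟨ge_of_mapClusterPt (hcl g hg) (Eventually.of_forall fun n => (hyle n g hg).1),
      le_of_mapClusterPt (hcl g hg) (Eventually.of_forall fun n => (hyle n g hg).2)⟩
  have hfx : ∀ N, f N x ≤ α (f N) + (1 / 2) ^ N := fun N =>
    le_of_mapClusterPt (hcl _ (hf N)) (by
      filter_upwards [eventually_gt_atTop N] with n hn using hlow N n hn)
  obtain ⟨D, hD⟩ := h.bdd.exists_norm_le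
  have hcoef : HasSum (fun n : ℕ => (1 / 2 : ℝ) * (1 / 2) ^ n) 1 := by
    simpa using hasSum_geometric_two.mul_left (1 / 2 : ℝ)
  have hsum : Summable fun n : ℕ => ((1 / 2 : ℝ) * (1 / 2) ^ n) • d n :=
    Summable.of_norm_bounded (hcoef.summable.mul_right D) fun n => by
      rw [norm_smul, Real.norm_of_nonneg (by positivity)]
      exact mul_le_mul_of_nonneg_left (norm_le_of_mem_acoInf hD (hd n)) (by positivity)
  obtain ⟨z, hz⟩ := hsum
  have hzA : z ∈ acoInf A := hasSum_mem_acoInf h.bdd hd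
    (hcoef.congr_fun fun n => abs_of_nonneg (by positivity)) hz
  have hgz : ∀ g : X →L[ℝ] ℝ, HasSum (fun n : ℕ => (1 / 2 : ℝ) * (1 / 2) ^ n * g (d n)) (g z) :=
    fun g => by simpa using hz.mapL g
  obtain ⟨g, hg, hmax⟩ := h.attains z hzA
  have hbound : ∀ N, 1 / 2 * (δ - 3 * (1 / 2) ^ N) - 2 * (δ * (2 / 3) ^ N) ≤ g z := fun N => by
    refine le_trans ?_ (hmax _ (hf N))
    have h1 := (hcoef.mul_right (1 / 2 * (δ - 3 * (1 / 2) ^ N))).sub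
      ((hasSum_geometric_of_lt_one (r := (3 / 4 : ℝ)) (by norm_num) (by norm_num)).mul_left
        (1 / 2 * (δ * (2 / 3) ^ N)))
    have h2 := hasSum_le (fun n => ?_) h1 (hgz (f N))
    · norm_num at h2 ⊢
      linarith
    have hpos : (0 : ℝ) < (1 / 2) ^ n := by positivity
    rw [hgd]
    rcases le_or_gt n N with hn | hn
    · have h3 := htop N n hn
      have h4 := hfx N
      have h5 : (0 : ℝ) ≤ 1 / 2 * (δ * (2 / 3) ^ N) * (3 / 4) ^ n := by positivity
      have h6 := mul_le_mul_of_nonneg_left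
        (show δ - 3 * (1 / 2) ^ N ≤ f N (y n) - f N x by linarith) hpos.le
      linarith
    · have h3 := (hyle n _ (hf N)).1
      have h4 := (hxle _ (hf N)).2
      have h5 : (3 / 4 : ℝ) ^ n = (1 / 2) ^ n * (3 / 2) ^ n := by
        rw [← mul_pow]
        norm_num
      have h6 : (1 : ℝ) ≤ (2 / 3) ^ N * (3 / 2) ^ n := by
        calc (1 : ℝ) = (2 / 3) ^ N * (3 / 2) ^ N := by rw [← mul_pow]; norm_num
          _ ≤ _ := by
            gcongr
            norm_num
      have h7 : (0 : ℝ) < (1 / 2) ^ N := by positivity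
      have h8 : (1 / 2 : ℝ) ^ n * δ ≤ δ * (2 / 3) ^ N * (3 / 4) ^ n := by
        rw [h5]
        have := mul_le_mul_of_nonneg_left h6 (mul_pos hpos hδ).le
        linarith
      have h9 := mul_le_mul_of_nonneg_left
        (show -δ ≤ f N (y n) - f N x by linarith) hpos.le
      have h10 := mul_pos hpos h7
      linarith
  have hgz_ge : δ / 2 ≤ g z := by
    have hlim : Tendsto (fun N : ℕ => 1 / 2 * (δ - 3 * (1 / 2 : ℝ) ^ N) - 2 * (δ * (2 / 3) ^ N))
        atTop (𝓝 (1 / 2 * (δ - 3 * 0) - 2 * (δ * 0))) :=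
      (((tendsto_pow_atTop_nhds_zero_of_lt_one (by norm_num) (by norm_num)).const_mul 3
        |>.const_sub δ).const_mul (1 / 2)).sub
        (((tendsto_pow_atTop_nhds_zero_of_lt_one (by norm_num) (by norm_num)).const_mul δ).const_mul
          2)
    have := le_of_tendsto' hlim hbound
    linarith
  obtain ⟨n, hn⟩ := ((hcl g hg).frequently (eventually_lt_nhds
    (show g x < g x + δ / 2 by linarith))).exists
  have hle : ∀ k, g (d k) ≤ δ / 2 := fun k => by
    have := (hyle k g hg).2
    have := (hxle g hg).1
    rw [hgd]
    linarith
  have hlt := hasSum_lt (i := n) (fun k => mul_le_mul_of_nonneg_left (hle k)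
    (show (0 : ℝ) ≤ 1 / 2 * (1 / 2) ^ k by positivity))
    (mul_lt_mul_of_pos_left (show g (d n) < δ / 2 by rw [hgd]; linarith)
      (show (0 : ℝ) < 1 / 2 * (1 / 2) ^ n by positivity)) (hgz g) (hcoef.mul_right (δ / 2))
  linarith

end IsOscillating

end Oscillation

section Convergence

variable {A : Set X} {F : Set (X →L[ℝ] ℝ)}

theorem eventually_mul_sub_lt [CompleteSpace X] (hA : IsBounded A) (hF : IsBounded F)
    (hmax : ∀ z ∈ acoInf A, ∃ f ∈ F, ∀ g ∈ F, g z ≤ f z) {g : X →L[ℝ] ℝ}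
    (hg : ∀ z ∈ acoInf A, ∃ f ∈ F, g z ≤ f z) {v : ℕ → X} (hv : ∀ n, v n ∈ A) {x : X} (hx : x ∈ A)
    (hlim : ∀ f ∈ F, Tendsto (fun n => f (v n)) atTop (𝓝 (f x))) {σ : ℝ} (hσ : |σ| = 1) {ε : ℝ}
    (hε : 0 < ε) : ∀ᶠ n in atTop, σ * (g (v n) - g x) < ε := by
  by_contra hcon
  obtain ⟨ψ, hψ, hge⟩ := extraction_of_frequently_atTop (not_eventually.1 hcon)
  let e : ℕ → X := fun k => (σ / 2) • v (ψ k) + (-(σ / 2)) • x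
  have he : ∀ k, e k ∈ acoInf A := fun k => smul_add_smul_mem_acoInf hA
    (by rw [abs_neg, abs_div, hσ]; norm_num) (subset_acoInf A (hv _)) (subset_acoInf A hx)
  have hfe : ∀ (f : X →L[ℝ] ℝ) k, f (e k) = σ * (f (v (ψ k)) - f x) / 2 := fun f k => by
    simp only [e, map_add, map_smul, smul_eq_mul]
    ring
  have hhull : ∀ z ∈ convexHull ℝ (Set.range e), ∃ f ∈ F, ε / 2 ≤ f z := fun z hz => by
    have h1 : convexHull ℝ (Set.range e) ⊆ {z | ε / 2 ≤ g z} := convexHull_min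
      (by
        rintro _ ⟨k, rfl⟩
        have := not_lt.1 (hge k)
        change _ ≤ g (e k)
        rw [hfe]
        linarith) (convex_halfSpace_ge g.toLinearMap.isLinear _)
    have h2 : convexHull ℝ (Set.range e) ⊆ acoInf A := convexHull_min
      (by rintro _ ⟨k, rfl⟩; exact he k) (convex_acoInf hA)
    obtain ⟨f, hf, hgf⟩ := hg z (h2 hz)
    exact ⟨f, hf, le_trans (h1 hz) hgf⟩
  obtain ⟨f, hf, hfreq⟩ := exists_frequently_lt hA hF hmax he hhull (ε := ε / 4) (by positivity)
  have ht : Tendsto (fun k => f (e k)) atTop (𝓝 0) := by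
    have := ((((hlim f hf).comp hψ.tendsto_atTop).sub_const (f x)).const_mul σ).div_const 2
    rw [sub_self, mul_zero, zero_div] at this
    exact this.congr fun k => (hfe f k).symm
  refine hfreq ((ht.eventually_lt_const (show 0 < ε / 2 - ε / 4 by linarith)).mono fun k hk => ?_)
  exact not_lt.2 hk.le

/-- A Rainwater type theorem. -/
theorem tendsto_of_tendsto_boundary [CompleteSpace X] (hA : IsBounded A) (hF : IsBounded F)
    (hmax : ∀ z ∈ acoInf A, ∃ f ∈ F, ∀ g ∈ F, g z ≤ f z) {g : X →L[ℝ] ℝ}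
    (hg : ∀ z ∈ acoInf A, ∃ f ∈ F, g z ≤ f z) {v : ℕ → X} (hv : ∀ n, v n ∈ A) {x : X} (hx : x ∈ A)
    (hlim : ∀ f ∈ F, Tendsto (fun n => f (v n)) atTop (𝓝 (f x))) :
    Tendsto (fun n => g (v n)) atTop (𝓝 (g x)) := by
  rw [Metric.tendsto_nhds]
  intro ε hε
  filter_upwards [eventually_mul_sub_lt hA hF hmax hg hv hx hlim (σ := 1) abs_one hε,
    eventually_mul_sub_lt hA hF hmax hg hv hx hlim (σ := -1) (by simp) hε] with n h1 h2
  rw [Real.dist_eq, abs_lt]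
  constructor <;> linarith

theorem tendsto_of_mapClusterPt {s : ℕ → ℝ} {a : ℝ} (h : MapClusterPt a atTop s)
    (hs : ∀ η > 0, ∃ N, ∀ k ≥ N, ∀ l ≥ N, s k - s l ≤ η) : Tendsto s atTop (𝓝 a) := by
  rw [Metric.tendsto_nhds]
  intro ε hε
  obtain ⟨N, hN⟩ := hs (ε / 2) (half_pos hε)
  filter_upwards [eventually_ge_atTop N] with k hk
  obtain ⟨l, hl, hNl⟩ := ((h.frequently (Metric.ball_mem_nhds a (half_pos hε))).and_eventually
    (eventually_ge_atTop N)).exists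
  rw [Real.dist_eq, abs_lt] at hl
  have h1 := hN k hk l hNl
  have h2 := hN l hNl k hk
  rw [Real.dist_eq, abs_lt]
  constructor <;> linarith

theorem eventually_near_liminf {s : ℕ → ℝ} {D δ : ℝ} (hD : ∀ k, |s k| ≤ D)
    (hs : ∀ η > 0, ∃ N, ∀ k ≥ N, ∀ l ≥ N, s k - s l ≤ δ + η) {η : ℝ} (hη : 0 < η) :
    ∀ᶠ k in atTop, liminf s atTop - η ≤ s k ∧ s k ≤ liminf s atTop + δ + η := by
  have hge : IsBoundedUnder (· ≥ ·) atTop s :=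
    isBoundedUnder_of ⟨-D, fun k => (abs_le.1 (hD k)).1⟩
  have hle : IsBoundedUnder (· ≤ ·) atTop s :=
    isBoundedUnder_of ⟨D, fun k => (abs_le.1 (hD k)).2⟩
  obtain ⟨N, hN⟩ := hs (η / 2) (half_pos hη)
  obtain ⟨l, hl, hNl⟩ := ((frequently_lt_of_liminf_lt hle.isCoboundedUnder_ge
    (show liminf s atTop < liminf s atTop + η / 2 by linarith)).and_eventually
      (eventually_ge_atTop N)).exists
  filter_upwards [eventually_ge_atTop N, eventually_lt_of_lt_liminf
    (show liminf s atTop - η < liminf s atTop by linarith) hge] with k hk hlt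
  exact ⟨hlt.le, by linarith [hN k hk l hNl]⟩

theorem continuous_ptwTop {D : Set (X →L[ℝ] ℝ)} {f : X →L[ℝ] ℝ} (hf : f ∈ D) :
    @Continuous X ℝ (ptwTop D) _ f :=
  @Continuous.comp X (D → ℝ) ℝ (ptwTop D) _ _ _ _ (continuous_apply (⟨f, hf⟩ : D))
    continuous_induced_dom

theorem tendsto_ptwTop {D : Set (X →L[ℝ] ℝ)} {v : ℕ → X} {x : X}
    (h : ∀ f ∈ D, Tendsto (fun n => f (v n)) atTop (𝓝 (f x))) :
    @Tendsto ℕ X v atTop (@nhds X (ptwTop D) x) := by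
  rw [ptwTop, nhds_induced, tendsto_comap_iff, tendsto_pi_nhds]
  exact fun f => h f.1 f.2

theorem subset_wstarClosure (D : Set (X →L[ℝ] ℝ)) : D ⊆ wstarClosure D :=
  @subset_closure _ (wstarTop X) D

theorem apply_le_of_mem_wstarClosure {x : X} {c : ℝ} (h : ∀ f ∈ F, f x ≤ c) {g : X →L[ℝ] ℝ}
    (hg : g ∈ wstarClosure (convexHull ℝ F)) : g x ≤ c := by
  have hconv : convexHull ℝ F ⊆ {g | g x ≤ c} :=
    convexHull_min h fun f hf g hg a b ha hb hab => by
      have h1 := mul_le_mul_of_nonneg_left hf ha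
      have h2 := mul_le_mul_of_nonneg_left hg hb
      change a * f x + b * g x ≤ c
      have h3 : a * c + b * c = c := by rw [← add_mul, hab, one_mul]
      linarith
  have hcont : @Continuous (X →L[ℝ] ℝ) ℝ (wstarTop X) _ fun g => g x :=
    @Continuous.comp (X →L[ℝ] ℝ) (X → ℝ) ℝ (wstarTop X) _ _ _ _ (continuous_apply x)
      continuous_induced_dom
  have hsub : wstarClosure (convexHull ℝ F) ⊆ {g | g x ≤ c} :=
    @closure_minimal (X →L[ℝ] ℝ) (wstarTop X) _ _ hconv
      (@IsClosed.preimage _ _ (wstarTop X) _ _ hcont _ isClosed_Iic)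
  exact hsub hg

end Convergence

/-- "boundary2.0": if for each `x ∈ aco_∞(A)` some `f ∈ F` satisfies
`f(x) = sup_{g ∈ cl_w*(co F)} g(x)`, then τ_F-countable compactness of `A` implies
τ_{cl_w*(co F)}-sequential compactness of `A`. -/
theorem stmt4 {X : Type*} [NormedAddCommGroup X] [NormedSpace ℝ X] [CompleteSpace X]
    (A : Set X) (F : Set (X →L[ℝ] ℝ))
    (hA : IsBounded A) (hF : IsBounded F)
    (hsup : ∀ x ∈ acoInf A, ∃ f ∈ F,
      f x = sSup ((fun g : X →L[ℝ] ℝ => g x) '' wstarClosure (convexHull ℝ F)))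
    -- `A` is τ_F-countably compact:
    (hcc : ∀ u : ℕ → X, (∀ n, u n ∈ A) →
      ∃ x ∈ A, @MapClusterPt X (ptwTop F) ℕ x atTop u) :
    -- `A` is τ_{cl_w*(co F)}-sequentially compact:
    ∀ u : ℕ → X, (∀ n, u n ∈ A) →
      ∃ x ∈ A, ∃ φ : ℕ → ℕ, StrictMono φ ∧
        @Tendsto ℕ X (u ∘ φ) atTop (@nhds X (ptwTop (wstarClosure (convexHull ℝ F))) x) := by
  intro u hu
  obtain ⟨R, hR⟩ := hF.exists_norm_le
  obtain ⟨D, hD⟩ := hA.exists_norm_le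
  have hatt : ∀ z ∈ acoInf A, ∃ f ∈ F, ∀ g ∈ wstarClosure (convexHull ℝ F), g z ≤ f z :=
    fun z hz => by
      obtain ⟨f, hf, hfz⟩ := hsup z hz
      refine ⟨f, hf, fun g hg => hfz ▸ le_csSup ⟨R * ‖z‖, ?_⟩ ⟨g, hg, rfl⟩⟩
      rintro _ ⟨g, hg, rfl⟩
      exact apply_le_of_mem_wstarClosure (fun f hf =>
        (Real.le_norm_self _).trans (f.le_of_opNorm_le (hR f hf) z)) hg
  have hFK : F ⊆ wstarClosure (convexHull ℝ F) :=
    (subset_convexHull ℝ F).trans (subset_wstarClosure _)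
  have hmax : ∀ z ∈ acoInf A, ∃ f ∈ F, ∀ g ∈ F, g z ≤ f z := fun z hz =>
    (hatt z hz).imp fun f hf => ⟨hf.1, fun g hg => hf.2 g (hFK hg)⟩
  have hcl : ∀ v : ℕ → X, (∀ n, v n ∈ A) →
      ∃ x ∈ A, ∀ f ∈ F, MapClusterPt (f x) atTop fun n => f (v n) := fun v hv =>
    (hcc v hv).imp fun x hx => ⟨hx.1, fun f hf =>
      @MapClusterPt.continuousAt_comp X (ptwTop F) _ _ _ _ _ _ _
        (@Continuous.continuousAt X ℝ (ptwTop F) _ _ _ (continuous_ptwTop hf)) hx.2⟩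
  have hne : Nonempty F := (hmax _ (subset_acoInf A (hu 0))).elim fun f hf => ⟨⟨f, hf.1⟩⟩
  have hb : ∀ (f : F) k, |f.1 (u k)| ≤ R * D := fun f k =>
    (f.1.le_of_opNorm_le (hR f.1 f.2) (u k)).trans
      (mul_le_mul_of_nonneg_left (hD _ (hu k)) ((norm_nonneg _).trans (hR f.1 f.2)))
  obtain ⟨φ, δ, hφ, hnear, hosc⟩ := exists_stable_oscillation hb
  have hδ : δ ≤ 0 := not_lt.1 fun hpos => IsOscillating.false (A := A) (F := F)
    (u := fun k => u (φ k)) (α := fun f => liminf (fun k => f (u (φ k))) atTop) (δ := δ)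
    { bdd := hA
      bddF := hF
      attains := hmax
      cluster := hcl
      mem := fun k => hu _
      pos := hpos
      near := fun f hf η hη =>
        eventually_near_liminf (fun k => hb ⟨f, hf⟩ (φ k)) (hnear ⟨f, hf⟩) hη
      osc := fun Y hY ε hε => (hosc Y hY ε hε).elim fun f hf => ⟨f.1, f.2, hf⟩ }
  obtain ⟨x, hx, hxcl⟩ := hcl (fun k => u (φ k)) fun k => hu _
  have hlim : ∀ f ∈ F, Tendsto (fun k => f (u (φ k))) atTop (𝓝 (f x)) := fun f hf =>
    tendsto_of_mapClusterPt (hxcl f hf) fun η hη => (hnear ⟨f, hf⟩ η hη).imp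
      fun N hN k hk l hl => (hN k hk l hl).trans (by linarith)
  exact ⟨x, hx, φ, hφ, tendsto_ptwTop fun g hg => tendsto_of_tendsto_boundary hA hF hmax
    (fun z hz => (hatt z hz).imp fun f hf => ⟨hf.1, hf.2 g hg⟩) (fun k => hu _) hx hlim⟩
end
end
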